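/- arXiv:2508.13643 — 6 statements merged into one kernel-verified Lean document; each statement's English description precedes it below -/
import Mathlib

section
/- Let c ≥ 2, k ≥ 2 and n ≥ max{50c, 50k} be integers. If G is an n-vertex C_{2k+1}-free simple graph with e(G) ≥ (n−c)²/4, then G contains subgraphs F and G' with F ⊆ G' such that: (a) F has at least n−10c vertices, every vertex of F has more than 2n/5 neighbors in F, and every vertex v ∈ V(G)∖V(F) has at most 2n/5 neighbors in V(F); (b) G' has at least n−2c vertices, every vertex of G' has at least 11c neighbors in G', and every vertex v ∈ V(G)∖V(G') has fewer than 11c neighbors in V(G'); (c) both F and G' are k-dense bipartite subgraphs of G. -/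
/-- A graph is `m`-cycle-free if it contains no cycle of length `m`. -/
def SimpleGraph.CycleFree {V : Type*} (G : SimpleGraph V) (m : ℕ) : Prop :=
  ∀ ⦃v : V⦄ (w : G.Walk v v), w.IsCycle → w.length ≠ m

/-- The spectral radius of a finite graph: the largest (real) eigenvalue of its
adjacency matrix, i.e. the supremum of the set of real eigenvalues. -/
noncomputable def SimpleGraph.specRad {V : Type*} [Fintype V] (G : SimpleGraph V) : ℝ :=
  letI : DecidableRel G.Adj := Classical.decRel _
  sSup {μ : ℝ | ∃ x : V → ℝ, x ≠ 0 ∧ (SimpleGraph.adjMatrix ℝ G).mulVec x = μ • x}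

/-- A graph is 2-connected if it has at least 3 vertices, is connected, and removing
any single vertex leaves it connected. -/
def SimpleGraph.TwoConnected {V : Type*} (G : SimpleGraph V) : Prop :=
  3 ≤ Nat.card V ∧ G.Connected ∧
    ∀ v : V, (G.induce (({v} : Set V)ᶜ)).Connected

/-- `turanSuspAt n q v0`: the `n`-vertex graph obtained from the complete bipartite graph
with parts `{0, …, q/2 - 1}` and `{q/2, …, q-1}` (the bipartite Turán graph `T_{q,2}`)
by putting a clique on `{v0} ∪ {q, …, n-1}`; for `v0 < q` this is `T_{q,2}` with a
clique `K_{n-q+1}` suspended at the vertex `v0`. -/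
def turanSuspAt (n q v0 : ℕ) : SimpleGraph (Fin n) :=
  SimpleGraph.fromRel (fun i j =>
    ((i : ℕ) < q / 2 ∧ q / 2 ≤ (j : ℕ) ∧ (j : ℕ) < q) ∨
    (((i : ℕ) = v0 ∨ q ≤ (i : ℕ)) ∧ ((j : ℕ) = v0 ∨ q ≤ (j : ℕ))))

/-- The family `𝒢_{n,r}`: graphs obtained from a bipartite graph by suspending graphs
`G_1, …, G_s` whose parts outside the bipartite graph have at most `r - 2` vertices
in total. -/
def FamilyG (n r : ℕ) (G : SimpleGraph (Fin n)) : Prop :=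
  ∃ (s : ℕ) (W : Fin s → Finset (Fin n)) (v : Fin s → Fin n),
    (∀ i j, i ≠ j → Disjoint (W i) (W j)) ∧
    (Finset.univ.biUnion W).card ≤ r - 2 ∧
    (∀ i, v i ∉ Finset.univ.biUnion W) ∧
    (∃ A : Set (Fin n), ∀ x y, G.Adj x y →
        x ∉ Finset.univ.biUnion W → y ∉ Finset.univ.biUnion W →
        ((x ∈ A ∧ y ∉ A) ∨ (x ∉ A ∧ y ∈ A))) ∧
    (∀ i j, i ≠ j → ∀ x ∈ W i, ∀ y ∈ W j, ¬ G.Adj x y) ∧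
    (∀ i, ∀ x ∈ W i, ∀ y, G.Adj x y → y ∉ Finset.univ.biUnion W → y = v i)

/-- The family `𝒢*_{n,r}`: as `FamilyG`, but with exactly `r - 2` vertices outside the
bipartite part. -/
def FamilyGStar (n r : ℕ) (G : SimpleGraph (Fin n)) : Prop :=
  ∃ (s : ℕ) (W : Fin s → Finset (Fin n)) (v : Fin s → Fin n),
    (∀ i j, i ≠ j → Disjoint (W i) (W j)) ∧
    (Finset.univ.biUnion W).card = r - 2 ∧
    (∀ i, v i ∉ Finset.univ.biUnion W) ∧
    (∃ A : Set (Fin n), ∀ x y, G.Adj x y →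
        x ∉ Finset.univ.biUnion W → y ∉ Finset.univ.biUnion W →
        ((x ∈ A ∧ y ∉ A) ∨ (x ∉ A ∧ y ∈ A))) ∧
    (∀ i j, i ≠ j → ∀ x ∈ W i, ∀ y ∈ W j, ¬ G.Adj x y) ∧
    (∀ i, ∀ x ∈ W i, ∀ y, G.Adj x y → y ∉ Finset.univ.biUnion W → y = v i)

/-- `H` is a `k`-dense bipartite graph: bipartite, 2-connected, any two distinct vertices
in the same part are joined by paths of every odd order `5 ≤ h ≤ 2k+1`, and any two
vertices in different parts are joined by paths of every even order `6 ≤ s ≤ 2k+2`. -/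
def KDenseBip {V : Type*} (k : ℕ) (H : SimpleGraph V) : Prop :=
  H.TwoConnected ∧
  ∃ A : Set V,
    (∀ ⦃x y : V⦄, H.Adj x y → ((x ∈ A ∧ y ∉ A) ∨ (x ∉ A ∧ y ∈ A))) ∧
    (∀ u v : V, u ≠ v → (u ∈ A ↔ v ∈ A) → ∀ h : ℕ, Odd h → 5 ≤ h → h ≤ 2 * k + 1 →
      ∃ p : H.Walk u v, p.IsPath ∧ p.length + 1 = h) ∧
    (∀ u v : V, ¬(u ∈ A ↔ v ∈ A) → ∀ s : ℕ, Even s → 6 ≤ s → s ≤ 2 * k + 2 →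
      ∃ p : H.Walk u v, p.IsPath ∧ p.length + 1 = s)

/-- The graph obtained from the complete bipartite graph with parts `{0, …, a}` (size `a+1`)
and `{a+1, …, a+b}` (size `b`) by identifying the vertex `0` with one vertex of a clique
on `r-1` vertices whose remaining `r-2` vertices `{a+b+1, …, a+b+r-2}` are new. -/
def bipCliqueGraph (a b r : ℕ) : SimpleGraph (Fin (a + b + r - 1)) :=
  SimpleGraph.fromRel (fun i j =>
    ((i : ℕ) ≤ a ∧ a + 1 ≤ (j : ℕ) ∧ (j : ℕ) ≤ a + b) ∨
    (((i : ℕ) = 0 ∨ a + b + 1 ≤ (i : ℕ)) ∧ ((j : ℕ) = 0 ∨ a + b + 1 ≤ (j : ℕ))))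

open Classical in
/-- The neighbours of `v` lying in the finset `S`. -/
noncomputable def SimpleGraph.nbrsIn {V : Type*} (G : SimpleGraph V) (S : Finset V) (v : V) :
    Finset V :=
  {w ∈ S | G.Adj v w}

namespace SimpleGraph

variable {V : Type*} {G : SimpleGraph V}

@[simp]
lemma mem_nbrsIn {S : Finset V} {v w : V} : w ∈ G.nbrsIn S v ↔ w ∈ S ∧ G.Adj v w := by
  simp [nbrsIn]

lemma nbrsIn_subset (S : Finset V) (v : V) : G.nbrsIn S v ⊆ S :=
  fun _ h => (mem_nbrsIn.1 h).1

lemma nbrsIn_mono (G : SimpleGraph V) {S T : Finset V} (h : S ⊆ T) (v : V) : G.nbrsIn S v ⊆ G.nbrsIn T v :=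
  fun w hw => by
    rw [mem_nbrsIn] at hw ⊢
    exact ⟨h hw.1, hw.2⟩

lemma card_nbrsIn_lt {S : Finset V} {v : V} (hv : v ∈ S) : (G.nbrsIn S v).card < S.card :=
  Finset.card_lt_card ⟨nbrsIn_subset _ _, fun h => by simpa using h hv⟩

lemma CycleFree.not_adj_of_isPath {m : ℕ} (h : G.CycleFree (m + 1)) (hm : 2 ≤ m) {u v : V}
    {p : G.Walk u v} (hp : p.IsPath) (hl : p.length = m) : ¬ G.Adj v u := by
  intro ha
  refine h (Walk.cons ha p) ((Walk.cons_isCycle_iff p ha).2 ⟨hp, fun he => ?_⟩) (by simp [hl])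
  cases p with
  | nil => simp at hl; omega
  | @cons _ b _ hb q =>
    rw [Walk.cons_isPath_iff] at hp
    rw [Walk.edges_cons, List.mem_cons] at he
    rcases he with he | he
    · have : v = b := by
        rcases Sym2.eq_iff.1 he with ⟨rfl, _⟩ | ⟨rfl, _⟩
        · exact (ha.ne rfl).elim
        · rfl
      subst this
      have := Walk.isPath_iff_nil.1 hp.1
      rw [Walk.length_cons, Walk.length_eq_zero_iff.2 this] at hl
      omega
    · exact hp.2 (Walk.snd_mem_support_of_mem_edges q he)

/-- Three sets whose pairwise intersections lie in `C`. -/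
lemma card_add_card_add_card_le [DecidableEq V] {X A B D C : Finset V} (hA : A ⊆ X) (hB : B ⊆ X)
    (hD : D ⊆ X) (hC : C ⊆ X) (hAB : A ∩ B ⊆ C) (hAD : A ∩ D ⊆ C) (hBD : B ∩ D ⊆ C) :
    A.card + B.card + D.card ≤ X.card + 2 * C.card := by
  have h1 : ((A \ C) ∪ (B \ C) ∪ (D \ C) ∪ C).card ≤ X.card := by
    apply Finset.card_le_card
    intro x
    simp only [Finset.mem_union, Finset.mem_sdiff]
    rintro (((h | h) | h) | h)
    exacts [hA h.1, hB h.1, hD h.1, hC h]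
  rw [Finset.card_union_of_disjoint, Finset.card_union_of_disjoint,
    Finset.card_union_of_disjoint] at h1
  · have := Finset.le_card_sdiff C A
    have := Finset.le_card_sdiff C B
    have := Finset.le_card_sdiff C D
    omega
  all_goals
    rw [Finset.disjoint_left]
    intro x
    have h1 := @hAB x
    have h2 := @hAD x
    have h3 := @hBD x
    simp only [Finset.mem_union, Finset.mem_sdiff, Finset.mem_inter] at *
    tauto

/-- In a graph of large minimum degree, a cycle of length `l + 1` (given as a path together with
the edge closing it) can be enlarged to a cycle of length `l + 3`. -/
lemma exists_cycle_add_two {X : Finset V} {d l : ℕ} (hd : ∀ v ∈ X, d ≤ (G.nbrsIn X v).card)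
    (hl : 2 ≤ l) (hdl : X.card + 2 * (l + 1) < 3 * d) {x y : V} (p : G.Walk y x) (hp : p.IsPath)
    (hpl : p.length = l) (hpX : ∀ z ∈ p.support, z ∈ X) (hxy : G.Adj x y) :
    ∃ (x' y' : V) (q : G.Walk y' x'), q.IsPath ∧ q.length = l + 2 ∧
      (∀ z ∈ q.support, z ∈ X) ∧ G.Adj x' y' := by
  classical
  cases p with
  | nil => simp at hpl; omega
  | @cons _ z _ hyz q =>
    rw [Walk.cons_isPath_iff] at hp
    rw [Walk.length_cons] at hpl
    have hxX : x ∈ X := hpX _ (Walk.end_mem_support _)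
    have hyX : y ∈ X := hpX _ (Walk.start_mem_support _)
    have hqX : ∀ z ∈ q.support, z ∈ X := fun z hz => hpX z (by simp [hz])
    have hzX : z ∈ X := hqX _ (Walk.start_mem_support _)
    set C : Finset V := insert y q.support.toFinset with hC
    have hCX : C ⊆ X := by
      intro a ha
      rw [hC, Finset.mem_insert, List.mem_toFinset] at ha
      rcases ha with rfl | ha
      exacts [hyX, hqX _ ha]
    have hCc : C.card = l + 1 := by
      rw [hC, Finset.card_insert_of_notMem (by simpa using hp.2),
        List.toFinset_card_of_nodup hp.1.support_nodup, Walk.length_support, hpl]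
    have hdX : d < X.card := (hd x hxX).trans_lt (card_nbrsIn_lt hxX)
    obtain ⟨w, hw, hwC⟩ : ∃ w ∈ G.nbrsIn X x, w ∉ C.erase x := by
      apply Finset.exists_mem_notMem_of_card_lt_card
      have := hd x hxX
      have := Finset.card_erase_le (s := C) (a := x)
      omega
    obtain ⟨w', hw', hwC'⟩ : ∃ w' ∈ G.nbrsIn X z, w' ∉ insert w (C.erase z) := by
      apply Finset.exists_mem_notMem_of_card_lt_card
      have := hd z hzX
      have := Finset.card_insert_le w (C.erase z)
      have : (C.erase z).card = l := by
        rw [Finset.card_erase_of_mem (by simp [hC]), hCc]; rfl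
      omega
    rw [mem_nbrsIn] at hw hw'
    have e1 : w ≠ x := hw.2.ne'
    have e2 : w' ≠ z := hw'.2.ne'
    simp only [hC, Finset.mem_erase, Finset.mem_insert, List.mem_toFinset] at hwC hwC'
    by_contra hcon
    have hAB : G.nbrsIn X w ∩ G.nbrsIn X w' ⊆ C := by
      intro a ha
      simp only [Finset.mem_inter, mem_nbrsIn] at ha
      by_contra haC
      simp only [hC, Finset.mem_insert, List.mem_toFinset] at haC
      have := ha.1.2.ne
      have := ha.2.2.ne
      refine hcon ⟨x, w, .cons ha.1.2 (.cons ha.2.2.symm (.cons hw'.2.symm q)), ?_, ?_, ?_, hw.2⟩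
      · simp only [Walk.cons_isPath_iff, Walk.support_cons, List.mem_cons]
        grind
      · simp [hpl]
      · simp only [Walk.support_cons, List.mem_cons]
        grind
    have hAD : G.nbrsIn X w ∩ G.nbrsIn X y ⊆ C := by
      intro a ha
      simp only [Finset.mem_inter, mem_nbrsIn] at ha
      by_contra haC
      simp only [hC, Finset.mem_insert, List.mem_toFinset] at haC
      have := ha.1.2.ne
      have := ha.2.2.ne
      refine hcon ⟨x, w, .cons ha.1.2 (.cons ha.2.2.symm (.cons hyz q)), ?_, ?_, ?_, hw.2⟩
      · simp only [Walk.cons_isPath_iff, Walk.support_cons, List.mem_cons]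
        grind
      · simp [hpl]
      · simp only [Walk.support_cons, List.mem_cons]
        grind
    have hBD : G.nbrsIn X w' ∩ G.nbrsIn X y ⊆ C := by
      intro a ha
      simp only [Finset.mem_inter, mem_nbrsIn] at ha
      by_contra haC
      simp only [hC, Finset.mem_insert, List.mem_toFinset] at haC
      have := ha.1.2.ne
      have := ha.2.2.ne
      refine hcon ⟨x, y, .cons ha.2.2 (.cons ha.1.2.symm (.cons hw'.2.symm q)), ?_, ?_, ?_, hxy⟩
      · simp only [Walk.cons_isPath_iff, Walk.support_cons, List.mem_cons]
        grind
      · simp [hpl]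
      · simp only [Walk.support_cons, List.mem_cons]
        grind
    have := card_add_card_add_card_le (nbrsIn_subset _ _) (nbrsIn_subset _ _)
      (nbrsIn_subset _ _) hCX hAB hAD hBD
    have := hd w hw.1
    have := hd w' hw'.1
    have := hd y hyX
    omega

/-- A graph of large minimum degree without odd cycles of a given short length is triangle-free. -/
lemma CycleFree.not_triangle {X : Finset V} {d k : ℕ} (hfree : G.CycleFree (2 * k + 1))
    (hk : 1 ≤ k) (hd : ∀ v ∈ X, d ≤ (G.nbrsIn X v).card) (hdk : X.card + 4 * k < 3 * d + 2)
    {a b c : V} (ha : a ∈ X) (hb : b ∈ X) (hc : c ∈ X) (hab : G.Adj a b) (hbc : G.Adj b c)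
    (hca : G.Adj c a) : False := by
  have key : ∀ j : ℕ, j + 1 ≤ k → ∃ (x y : V) (q : G.Walk y x), q.IsPath ∧
      q.length = 2 * (j + 1) ∧ (∀ z ∈ q.support, z ∈ X) ∧ G.Adj x y := by
    intro j
    induction j with
    | zero =>
      intro _
      refine ⟨c, a, .cons hab (.cons hbc .nil), ?_, ?_, ?_, hca⟩
      · have := hab.ne
        have := hbc.ne
        have := hca.ne
        simp only [Walk.cons_isPath_iff, Walk.support_cons, Walk.support_nil, List.mem_cons]
        simp
        grind
      · simp
      · simp [ha, hb, hc]
    | succ j ih =>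
      intro hj
      obtain ⟨x, y, q, hq, hl, hX, hxy⟩ := ih (by omega)
      exact exists_cycle_add_two (l := 2 * (j + 1)) hd (by omega) (by omega) q hq hl hX hxy
  obtain ⟨x, y, q, hq, hl, -, hxy⟩ := key (k - 1) (by omega)
  exact hfree.not_adj_of_isPath (by omega) hq (by omega) hxy

lemma degree_induce_eq_card_nbrsIn (X : Finset V) (v : (X : Set V))
    [Fintype ((G.induce (X : Set V)).neighborSet v)] :
    (G.induce (X : Set V)).degree v = (G.nbrsIn X v).card := by
  classical
  rw [degree, ← Finset.card_map (Function.Embedding.subtype _)]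
  congr 1
  ext w
  simp [and_comm]

/-- The Andrásfai theorem for induced subgraphs: large minimum degree and no triangle force
bipartiteness. -/
lemma exists_bipartition {X : Finset V} (hd : ∀ v ∈ X, 2 * X.card < 5 * (G.nbrsIn X v).card)
    (htri : ∀ a ∈ X, ∀ b ∈ X, ∀ c ∈ X, G.Adj a b → G.Adj b c → ¬ G.Adj c a) :
    ∃ A : Set V, ∀ x ∈ X, ∀ y ∈ X, G.Adj x y → (x ∈ A ↔ y ∉ A) := by
  classical
  rcases X.eq_empty_or_nonempty with rfl | hne
  · exact ⟨∅, by simp⟩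
  have : Nonempty (X : Set V) := hne.to_subtype
  have hcf : (G.induce (X : Set V)).CliqueFree (2 + 1) := by
    intro s hs
    obtain ⟨a, b, c, hab, hac, hbc, -⟩ := is3Clique_iff.1 hs
    exact htri a a.2 b b.2 c c.2 hab hbc hac.symm
  obtain ⟨C⟩ := colorable_of_cliqueFree_lt_minDegree hcf (by
    obtain ⟨v, hv⟩ := (G.induce (X : Set V)).exists_minimal_degree_vertex
    rw [hv, degree_induce_eq_card_nbrsIn]
    have := hd v v.2
    simp
    omega)
  refine ⟨{v | ∃ h : v ∈ X, C ⟨v, h⟩ = 0}, fun x hx y hy hxy => ?_⟩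
  have := C.valid (v := ⟨x, hx⟩) (w := ⟨y, hy⟩) hxy
  simp only [Set.mem_ofPred_eq, hx, hy, exists_true_left]
  generalize C ⟨x, hx⟩ = i at *
  generalize C ⟨y, hy⟩ = j at *
  revert i j
  decide

lemma sum_card_nbrsIn_erase [DecidableEq V] {S : Finset V} {v : V} (hv : v ∈ S) :
    ∑ w ∈ S, (G.nbrsIn S w).card =
      ∑ w ∈ S.erase v, (G.nbrsIn (S.erase v) w).card + 2 * (G.nbrsIn S v).card := by
  classical
  have h1 : ∀ w ∈ S.erase v,
      (G.nbrsIn S w).card = (G.nbrsIn (S.erase v) w).card + if G.Adj v w then 1 else 0 := by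
    intro w _
    have : G.nbrsIn (S.erase v) w = (G.nbrsIn S w).erase v := by
      ext u
      simp [and_assoc]
    rw [this]
    split_ifs with h
    · rw [Finset.card_erase_add_one (by simp [hv, h.symm])]
    · rw [Finset.erase_eq_of_notMem (by simp [G.adj_comm w v, h]), add_zero]
  have h2 : ∑ w ∈ S.erase v, (if G.Adj v w then 1 else 0) = (G.nbrsIn S v).card := by
    rw [← Finset.card_filter]
    congr 1
    ext w
    have : G.Adj v w → w ≠ v := fun h => h.ne'
    simp only [Finset.mem_filter, Finset.mem_erase, mem_nbrsIn]
    tauto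
  rw [← Finset.add_sum_erase S _ hv, Finset.sum_congr rfl h1, Finset.sum_add_distrib, h2]
  ring

lemma sum_card_nbrsIn_univ [Fintype V] :
    ∑ w, (G.nbrsIn Finset.univ w).card = 2 * G.edgeSet.ncard := by
  classical
  rw [Set.ncard_eq_toFinset_card', ← edgeFinset, ← sum_degrees_eq_twice_card_edges]
  refine Finset.sum_congr rfl fun v _ => ?_
  rw [degree]
  congr 1
  ext w
  simp

lemma sum_card_nbrsIn_le_of_bipartition {S : Finset V} {A : Set V}
    (hA : ∀ x ∈ S, ∀ y ∈ S, G.Adj x y → (x ∈ A ↔ y ∉ A)) :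
    2 * ∑ w ∈ S, (G.nbrsIn S w).card ≤ S.card ^ 2 := by
  classical
  have h1 : ∑ w ∈ S with w ∈ A, (G.nbrsIn S w).card ≤
      (S.filter (· ∈ A)).card * (S.filter (· ∉ A)).card := by
    rw [← smul_eq_mul]
    refine Finset.sum_le_card_nsmul _ _ _ fun w hw => Finset.card_le_card fun u hu => ?_
    rw [Finset.mem_filter] at hw ⊢
    rw [mem_nbrsIn] at hu
    exact ⟨hu.1, (hA w hw.1 u hu.1 hu.2).1 hw.2⟩
  have h2 : ∑ w ∈ S with w ∉ A, (G.nbrsIn S w).card ≤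
      (S.filter (· ∉ A)).card * (S.filter (· ∈ A)).card := by
    rw [← smul_eq_mul]
    refine Finset.sum_le_card_nsmul _ _ _ fun w hw => Finset.card_le_card fun u hu => ?_
    rw [Finset.mem_filter] at hw ⊢
    rw [mem_nbrsIn] at hu
    exact ⟨hu.1, (hA u hu.1 w hw.1 hu.2.symm).2 hw.2⟩
  have h3 := Finset.sum_filter_add_sum_filter_not S (· ∈ A) (fun w => (G.nbrsIn S w).card)
  have h4 := Finset.card_filter_add_card_filter_not (s := S) (· ∈ A)
  rw [← h3, ← h4]
  nlinarith [sq_nonneg (((S.filter (· ∈ A)).card : ℤ) - (S.filter (· ∉ A)).card)]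

/-- A `C_{2k+1}`-free graph on `m ≥ 40k` vertices has at most `m² / 4` edges. -/
lemma CycleFree.two_mul_sum_card_nbrsIn_le {k : ℕ} (hk : 2 ≤ k) (hfree : G.CycleFree (2 * k + 1))
    (T : Finset V) (hT : 40 * k ≤ T.card) :
    2 * ∑ w ∈ T, (G.nbrsIn T w).card ≤ T.card ^ 2 := by
  classical
  by_contra! hcon
  let f : Finset V → ℤ := fun S =>
    20 * (∑ w ∈ S, (G.nbrsIn S w).card : ℕ) - 9 * ((S.card : ℤ) ^ 2 + S.card)
  obtain ⟨S, hST, hmax⟩ := Finset.exists_max_image T.powerset f ⟨T, by simp⟩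
  rw [Finset.mem_powerset] at hST
  have hdeg : ∀ v ∈ S, 9 * S.card ≤ 20 * (G.nbrsIn S v).card := by
    intro v hv
    have h1 := hmax (S.erase v) (by
      rw [Finset.mem_powerset]
      exact (Finset.erase_subset _ _).trans hST)
    have h2 := Finset.card_erase_add_one hv
    simp only [f, sum_card_nbrsIn_erase hv, ← h2] at h1
    rw [← h2]
    push_cast at h1
    zify
    nlinarith
  have hfT := hmax T (by simp)
  have hle := Finset.card_le_card hST
  have hsum : ∑ w ∈ S, (G.nbrsIn S w).card ≤ S.card * (S.card - 1) := by
    rw [← smul_eq_mul]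
    exact Finset.sum_le_card_nsmul _ _ _ fun w hw => Nat.le_sub_one_of_lt (card_nbrsIn_lt hw)
  simp only [f] at hfT
  generalize hDS : ∑ w ∈ S, (G.nbrsIn S w).card = DS at *
  generalize hDT : ∑ w ∈ T, (G.nbrsIn T w).card = DT at *
  have hbig : 80 * k < 7 * S.card + 40 := by
    by_contra! hs
    rcases Nat.eq_zero_or_pos S.card with h0 | hpos
    · rw [h0] at hsum hfT
      simp at hsum
      subst hsum
      zify at hcon hT hk
      push_cast at hfT
      nlinarith
    · zify [hpos] at hsum hcon hT hk hs
      have h5 : (T.card : ℤ) ^ 2 - 9 * T.card ≥ 1600 * k ^ 2 - 360 * k := by nlinarith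
      have h6 : (49 : ℤ) * (S.card : ℤ) ^ 2 ≤ (80 * k - 40) ^ 2 := by nlinarith
      nlinarith
  have hlt : S.card ^ 2 < 2 * DS := by
    zify at hcon ⊢
    zify at hT hle hk
    nlinarith
  have hbip : ∃ A : Set V, ∀ x ∈ S, ∀ y ∈ S, G.Adj x y → (x ∈ A ↔ y ∉ A) := by
    refine exists_bipartition (fun v hv => ?_) fun a ha b hb c hc hab hbc hca => ?_
    · have := hdeg v hv
      have := Finset.card_pos.2 ⟨v, hv⟩
      omega
    · refine hfree.not_triangle (d := (9 * S.card + 19) / 20) (by omega) (fun v hv => ?_) ?_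
        ha hb hc hab hbc hca
      · have := hdeg v hv
        omega
      · omega
  obtain ⟨A, hA⟩ := hbip
  have := sum_card_nbrsIn_le_of_bipartition hA
  omega

/-- Deleting vertices of small degree one after another either gets stuck at a set of large
minimum degree, or removes few edges. -/
lemma exists_large_minDegree_or [Fintype V] (G : SimpleGraph V) (d t : ℕ)
    (ht : t ≤ Fintype.card V) :
    (∃ S : Finset V, Fintype.card V < S.card + t ∧ ∀ v ∈ S, d < (G.nbrsIn S v).card) ∨
    ∃ S : Finset V, S.card + t = Fintype.card V ∧
      2 * G.edgeSet.ncard ≤ ∑ w ∈ S, (G.nbrsIn S w).card + 2 * d * t := by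
  classical
  induction t with
  | zero => exact Or.inr ⟨Finset.univ, by simp, by simp [sum_card_nbrsIn_univ]⟩
  | succ t ih =>
    rcases ih (by omega) with ⟨S, hS, hd⟩ | ⟨S, hS, hsum⟩
    · exact Or.inl ⟨S, by omega, hd⟩
    · by_cases h : ∀ v ∈ S, d < (G.nbrsIn S v).card
      · exact Or.inl ⟨S, by omega, h⟩
      · push Not at h
        obtain ⟨v, hv, hvd⟩ := h
        refine Or.inr ⟨S.erase v, ?_, ?_⟩
        · have := Finset.card_erase_add_one hv
          omega
        · rw [sum_card_nbrsIn_erase hv] at hsum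
          rw [mul_add, mul_one]
          omega

/-- Any set of minimum degree more than `d` extends to one that no further vertex can join. -/
lemma exists_maximal_minDegree [Fintype V] {d : ℕ} {S₀ : Finset V}
    (h₀ : ∀ v ∈ S₀, d < (G.nbrsIn S₀ v).card) :
    ∃ S : Finset V, S₀ ⊆ S ∧ (∀ v ∈ S, d < (G.nbrsIn S v).card) ∧
      ∀ v ∉ S, (G.nbrsIn S v).card ≤ d := by
  classical
  obtain ⟨S, hS, hmax⟩ := Finset.exists_max_image
    {S : Finset V | S₀ ⊆ S ∧ ∀ v ∈ S, d < (G.nbrsIn S v).card} Finset.card ⟨S₀, by simpa⟩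
  simp only [Finset.mem_filter, Finset.mem_univ, true_and] at hS hmax
  refine ⟨S, hS.1, hS.2, fun v hv => ?_⟩
  by_contra! hlt
  have hmono := fun w => Finset.card_le_card (G.nbrsIn_mono (Finset.subset_insert v S) w)
  have := hmax (insert v S) ⟨hS.1.trans (Finset.subset_insert _ _), fun w hw => by
    rcases Finset.mem_insert.1 hw with rfl | hw
    · exact hlt.trans_le (hmono _)
    · exact (hS.2 w hw).trans_le (hmono _)⟩
  rw [Finset.card_insert_of_notMem hv] at this
  omega

open Classical in
/-- `X` induces a bipartite graph with sides `X ∩ A` and `X \ A`, in which all degrees, and all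
codegrees of pairs of vertices on the same side, are at least `M`. -/
structure IsDenseCore (G : SimpleGraph V) (X : Finset V) (A : Set V) (M : ℕ) : Prop where
  bip : ∀ x ∈ X, ∀ y ∈ X, G.Adj x y → (x ∈ A ↔ y ∉ A)
  le_deg : ∀ x ∈ X, M ≤ (G.nbrsIn X x).card
  le_codeg : ∀ u ∈ X, ∀ v ∈ X, u ≠ v → (u ∈ A ↔ v ∈ A) →
    M ≤ (G.nbrsIn X u ∩ G.nbrsIn X v).card

/-- There is a path with `l` edges from `u` to `v` all of whose vertices lie in `S`. -/
def HasPathIn (G : SimpleGraph V) (S : Set V) (u v : V) (l : ℕ) : Prop :=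
  ∃ p : G.Walk u v, p.IsPath ∧ p.length = l ∧ ∀ x ∈ p.support, x ∈ S

lemma HasPathIn.mono {S T : Set V} {u v : V} {l : ℕ} (h : G.HasPathIn S u v l) (hST : S ⊆ T) :
    G.HasPathIn T u v l := by
  obtain ⟨p, hp, hl, hS⟩ := h
  exact ⟨p, hp, hl, fun x hx => hST (hS x hx)⟩

lemma HasPathIn.symm {S : Set V} {u v : V} {l : ℕ} (h : G.HasPathIn S u v l) :
    G.HasPathIn S v u l := by
  obtain ⟨p, hp, hl, hS⟩ := h
  exact ⟨p.reverse, hp.reverse, by simpa, fun x hx => hS x (by simpa using hx)⟩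

lemma HasPathIn.cons {S : Set V} {u v w : V} {l : ℕ} (h : G.HasPathIn S u v l) (hw : G.Adj w u)
    (hwS : w ∉ S) : G.HasPathIn (insert w S) w v (l + 1) := by
  obtain ⟨p, hp, hl, hS⟩ := h
  refine ⟨.cons hw p, ?_, by simp [hl], fun x hx => ?_⟩
  · rw [Walk.cons_isPath_iff]
    exact ⟨hp, fun h => hwS (hS w h)⟩
  · rw [Walk.support_cons, List.mem_cons] at hx
    exact hx.imp id (hS x)

lemma HasPathIn.not_adj {S : Set V} {u v : V} {m : ℕ} (h : G.HasPathIn S u v m) (hm : 2 ≤ m)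
    (hfree : G.CycleFree (m + 1)) : ¬ G.Adj v u := by
  obtain ⟨p, hp, hl, -⟩ := h
  exact hfree.not_adj_of_isPath hm hp hl

namespace IsDenseCore

variable {X : Finset V} {A : Set V} {M : ℕ}

lemma hasPathIn_even (h : G.IsDenseCore X A M) (j : ℕ) (Z : Finset V)
    (hZ : Z.card + 2 * (j + 1) ≤ M) {u v : V} (hu : u ∈ X) (hv : v ∈ X) (huZ : u ∉ Z)
    (hvZ : v ∉ Z) (huv : u ≠ v) (hA : u ∈ A ↔ v ∈ A) :
    G.HasPathIn {x | x ∈ X ∧ x ∉ Z} u v (2 * (j + 1)) := by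
  classical
  induction j generalizing Z u with
  | zero =>
    obtain ⟨y, hy, hyZ⟩ := Finset.exists_mem_notMem_of_card_lt_card
      (s := Z) (t := G.nbrsIn X u ∩ G.nbrsIn X v) (by
        have := h.le_codeg u hu v hv huv hA
        omega)
    simp only [Finset.mem_inter, mem_nbrsIn] at hy
    refine ⟨.cons hy.1.2 (.cons hy.2.2.symm .nil), ?_, by simp, ?_⟩
    · have := hy.1.2.ne
      have := hy.2.2.ne'
      simp [Walk.cons_isPath_iff]
      grind
    · simp [hu, hv, huZ, hvZ, hy, hyZ]
  | succ j ih =>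
    obtain ⟨y, hy, hyZ⟩ := Finset.exists_mem_notMem_of_card_lt_card
      (s := insert v Z) (t := G.nbrsIn X u) (by
        have := h.le_deg u hu
        have := Finset.card_insert_le v Z
        omega)
    rw [mem_nbrsIn] at hy
    rw [Finset.mem_insert, not_or] at hyZ
    obtain ⟨x, hx, hxZ⟩ := Finset.exists_mem_notMem_of_card_lt_card
      (s := insert u (insert v Z)) (t := G.nbrsIn X y) (by
        have := h.le_deg y hy.1
        have := Finset.card_insert_le v Z
        have := Finset.card_insert_le u (insert v Z)
        omega)
    rw [mem_nbrsIn] at hx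
    simp only [Finset.mem_insert, not_or] at hxZ
    have hyu := hy.2.ne'
    have hxy := hx.2.ne'
    have h1 := h.bip u hu y hy.1 hy.2
    have h2 := h.bip y hy.1 x hx.1 hx.2
    have hp := ih (insert u (insert y Z)) (by
        have := Finset.card_insert_le y Z
        have := Finset.card_insert_le u (insert y Z)
        omega) hx.1 (by simp; tauto) (by simp; tauto) hxZ.2.1 (by tauto)
    refine ((hp.cons hx.2 (by simp)).cons hy.2 (by simp; tauto)).mono fun a ha => ?_
    simp only [Set.mem_insert_iff, Set.mem_ofPred_eq, Finset.mem_insert, not_or] at ha ⊢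
    rcases ha with rfl | rfl | ha
    exacts [⟨hu, huZ⟩, ⟨hy.1, hyZ.2⟩, ⟨ha.1, ha.2.2.2⟩]

lemma hasPathIn_odd (h : G.IsDenseCore X A M) (j : ℕ) (Z : Finset V)
    (hZ : Z.card + 2 * (j + 1) + 1 ≤ M) {u v : V} (hu : u ∈ X) (hv : v ∈ X) (huZ : u ∉ Z)
    (hvZ : v ∉ Z) (hA : ¬ (u ∈ A ↔ v ∈ A)) :
    G.HasPathIn {x | x ∈ X ∧ x ∉ Z} u v (2 * (j + 1) + 1) := by
  classical
  obtain ⟨y, hy, hyZ⟩ := Finset.exists_mem_notMem_of_card_lt_card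
    (s := insert v Z) (t := G.nbrsIn X u) (by
      have := h.le_deg u hu
      have := Finset.card_insert_le v Z
      omega)
  rw [mem_nbrsIn] at hy
  rw [Finset.mem_insert, not_or] at hyZ
  have h1 := h.bip u hu y hy.1 hy.2
  have hp := h.hasPathIn_even j (insert u Z) (by
    have := Finset.card_insert_le u Z
    omega) hy.1 hv (by
      have := hy.2.ne'
      simp; tauto) (by
      have : v ≠ u := by rintro rfl; exact hA Iff.rfl
      simp; tauto) hyZ.1 (by tauto)
  refine (hp.cons hy.2 (by simp)).mono fun a ha => ?_
  simp only [Set.mem_insert_iff, Set.mem_ofPred_eq, Finset.mem_insert, not_or] at ha ⊢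
  rcases ha with rfl | ha
  exacts [⟨hu, huZ⟩, ⟨ha.1, ha.2.2⟩]

lemma hasPathIn (h : G.IsDenseCore X A M) (Z : Finset V) {l : ℕ} (hl : 2 ≤ l)
    (hZ : Z.card + l ≤ M) {u v : V} (hu : u ∈ X) (hv : v ∈ X) (huZ : u ∉ Z) (hvZ : v ∉ Z)
    (huv : u ≠ v) (hA : Even l ↔ (u ∈ A ↔ v ∈ A)) :
    G.HasPathIn {x | x ∈ X ∧ x ∉ Z} u v l := by
  rcases Nat.even_or_odd' l with ⟨j, rfl | rfl⟩
  · obtain ⟨j, rfl⟩ : ∃ i, j = i + 1 := ⟨j - 1, by omega⟩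
    exact h.hasPathIn_even j Z hZ hu hv huZ hvZ huv (hA.1 (by simp))
  · obtain ⟨j, rfl⟩ : ∃ i, j = i + 1 := ⟨j - 1, by omega⟩
    refine h.hasPathIn_odd j Z hZ hu hv huZ hvZ fun hh => ?_
    have := hA.2 hh
    rw [Nat.even_iff] at this
    omega

/-- The core together with a set `S` of further vertices, each having at least three neighbours
in the core: there are paths between arbitrary vertices. -/
lemma hasPathIn_of_three_le (h : G.IsDenseCore X A M) {S : Finset V} (hXS : X ⊆ S)
    (hbip : ∀ x ∈ S, ∀ y ∈ S, G.Adj x y → (x ∈ A ↔ y ∉ A))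
    (hthree : ∀ v ∈ S, 3 ≤ (G.nbrsIn X v).card) {Z : Finset V} (hZ1 : Z.card ≤ 1)
    {l : ℕ} (hl : 4 ≤ l) (hZ : Z.card + l ≤ M) {u v : V} (hu : u ∈ S) (hv : v ∈ S)
    (huZ : u ∉ Z) (hvZ : v ∉ Z) (huv : u ≠ v) (hA : Even l ↔ (u ∈ A ↔ v ∈ A)) :
    G.HasPathIn {x | x ∈ S ∧ x ∉ Z} u v l := by
  classical
  have one : ∀ {l : ℕ} {u v : V}, 3 ≤ l → Z.card + l ≤ M → u ∈ S → v ∈ X → u ∉ Z → v ∉ Z →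
      u ≠ v → (Even l ↔ (u ∈ A ↔ v ∈ A)) →
      G.HasPathIn (insert u {x | x ∈ X ∧ x ∉ Z}) u v l := by
    intro l u v hl hZ hu hv huZ hvZ huv hA
    by_cases huX : u ∈ X
    · exact (h.hasPathIn Z (by omega) hZ huX hv huZ hvZ huv hA).mono (Set.subset_insert _ _)
    · obtain ⟨l, rfl⟩ : ∃ i, l = i + 1 := ⟨l - 1, by omega⟩
      obtain ⟨y, hy, hyZ⟩ := Finset.exists_mem_notMem_of_card_lt_card
        (s := insert v Z) (t := G.nbrsIn X u) (by
          have := hthree u hu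
          have := Finset.card_insert_le v Z
          omega)
      rw [mem_nbrsIn] at hy
      rw [Finset.mem_insert, not_or] at hyZ
      have h1 := hbip u hu y (hXS hy.1) hy.2
      rw [Nat.even_add_one] at hA
      exact (h.hasPathIn Z (by omega) (by omega) hy.1 hv hyZ.2 hvZ hyZ.1 (by tauto)).cons hy.2
        (by simp [huX])
  by_cases hvX : v ∈ X
  · refine (one (by omega) hZ hu hvX huZ hvZ huv hA).mono fun a ha => ?_
    rcases ha with rfl | ha
    exacts [⟨hu, huZ⟩, ⟨hXS ha.1, ha.2⟩]
  · obtain ⟨l, rfl⟩ : ∃ i, l = i + 1 := ⟨l - 1, by omega⟩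
    obtain ⟨y, hy, hyZ⟩ := Finset.exists_mem_notMem_of_card_lt_card
      (s := insert u Z) (t := G.nbrsIn X v) (by
        have := hthree v hv
        have := Finset.card_insert_le u Z
        omega)
    rw [mem_nbrsIn] at hy
    rw [Finset.mem_insert, not_or] at hyZ
    have h1 := hbip v hv y (hXS hy.1) hy.2
    rw [Nat.even_add_one] at hA
    have hp := one (l := l) (by omega) (by omega) hu hy.1 huZ hyZ.2 (Ne.symm hyZ.1) (by tauto)
    refine (hp.symm.cons hy.2 (by simp [hvX, Ne.symm huv])).symm.mono fun a ha => ?_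
    rcases ha with rfl | rfl | ha
    exacts [⟨hv, hvZ⟩, ⟨hu, huZ⟩, ⟨hXS ha.1, ha.2⟩]

end IsDenseCore

lemma HasPathIn.induce {S T : Set V} {u v : V} {l : ℕ} (h : G.HasPathIn T u v l) (hTS : T ⊆ S)
    (hu : u ∈ S) (hv : v ∈ S) : ∃ p : (G.induce S).Walk ⟨u, hu⟩ ⟨v, hv⟩, p.IsPath ∧
      p.length = l ∧ ∀ x ∈ p.support, (x : V) ∈ T := by
  obtain ⟨p, hp, hl, hT⟩ := h
  have hmap := Walk.map_induce p (fun x hx => hTS (hT x hx))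
  refine ⟨p.induce S fun x hx => hTS (hT x hx), ?_, ?_, fun x hx => hT x ?_⟩
  · rw [← hmap] at hp
    exact hp.of_map
  · rw [← hl, ← Walk.length_map (Embedding.induce S).toHom, hmap]
    rfl
  · have := List.mem_map_of_mem (f := (Embedding.induce (G := G) S).toHom) hx
    rwa [← Walk.support_map, hmap] at this

lemma IsDenseCore.kDenseBip {X S : Finset V} {A : Set V} {M k : ℕ} (h : G.IsDenseCore X A M)
    (hk : 2 ≤ k) (hM : 2 * k + 2 ≤ M) (hXS : X ⊆ S) (hcard : 3 ≤ S.card)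
    (hbip : ∀ x ∈ S, ∀ y ∈ S, G.Adj x y → (x ∈ A ↔ y ∉ A))
    (hthree : ∀ v ∈ S, 3 ≤ (G.nbrsIn X v).card) :
    KDenseBip k (G.induce (S : Set V)) := by
  classical
  have hpath : ∀ (u v : (S : Set V)) (l : ℕ), 4 ≤ l → l ≤ 2 * k + 1 → u ≠ v →
      (Even l ↔ ((u : V) ∈ A ↔ (v : V) ∈ A)) →
      ∃ p : (G.induce (S : Set V)).Walk u v, p.IsPath ∧ p.length = l := by
    intro u v l hl hlk huv hA
    obtain ⟨p, hp, hl, -⟩ := (h.hasPathIn_of_three_le hXS hbip hthree (Z := ∅) (by simp) hl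
      (by simp; omega) u.2 v.2 (by simp) (by simp) (Subtype.coe_injective.ne huv) hA).induce
      (S := (S : Set V)) (fun x hx => hx.1) u.2 v.2
    exact ⟨p, hp, hl⟩
  have hlen : ∀ u v : V, ∃ l, 4 ≤ l ∧ l ≤ 5 ∧ (Even l ↔ (u ∈ A ↔ v ∈ A)) := by
    intro u v
    by_cases huv : u ∈ A ↔ v ∈ A
    · exact ⟨4, by omega, by omega, by simp [huv]; decide⟩
    · exact ⟨5, by omega, by omega, by simp only [huv, iff_false]; decide⟩
  refine ⟨⟨by simpa using hcard, ?_, fun w => ?_⟩, {x | (x : V) ∈ A}, ?_, ?_, ?_⟩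
  · have : Nonempty (S : Set V) := (Finset.card_pos.1 (by omega : 0 < S.card)).to_subtype
    refine ⟨fun u v => ?_⟩
    by_cases huv : u = v
    · subst huv; rfl
    · obtain ⟨l, hl4, hl5, hl⟩ := hlen u v
      obtain ⟨p, -⟩ := hpath u v l hl4 (by omega) huv hl
      exact ⟨p⟩
  · have : Nonempty ↑({w}ᶜ : Set (S : Set V)) := by
      obtain ⟨y, hy, hyw⟩ := Finset.exists_mem_ne (by omega : 1 < S.card) (w : V)
      exact ⟨⟨y, hy⟩, fun h => hyw (congrArg Subtype.val h)⟩
    refine ⟨fun u v => ?_⟩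
    by_cases huv : u = v
    · subst huv; rfl
    · obtain ⟨l, hl4, hl5, hl⟩ := hlen u v
      have hne : ∀ x : ({w}ᶜ : Set (S : Set V)), (x : V) ∉ ({(w : V)} : Finset V) := by
        intro x hx
        exact x.2 (Subtype.ext (by simpa using hx))
      obtain ⟨p, -, -, hp⟩ := (h.hasPathIn_of_three_le hXS hbip hthree (Z := {(w : V)})
        (by simp) hl4 (by simp; omega) u.1.2 v.1.2 (hne u) (hne v)
        (fun h => huv (Subtype.ext (Subtype.ext h))) hl).induce
        (S := (S : Set V)) (fun x hx => hx.1) u.1.2 v.1.2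
      exact ⟨p.induce ({w}ᶜ : Set (S : Set V)) fun x hx hxw => (hp x hx).2 (by
        rw [Set.mem_singleton_iff.1 hxw]; simp)⟩
  · intro x y hxy
    have := hbip x x.2 y y.2 hxy
    simp only [Set.mem_ofPred_eq]
    tauto
  · intro u v huv hA l hlo hl5 hlk
    obtain ⟨l, rfl⟩ : ∃ i, l = i + 1 := ⟨l - 1, by omega⟩
    obtain ⟨p, hp, hl⟩ := hpath u v l (by omega) (by omega) huv (by
      rw [Nat.odd_add_one, Nat.not_odd_iff_even] at hlo
      exact iff_of_true hlo hA)
    exact ⟨p, hp, by rw [hl]⟩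
  · intro u v hA l hle hl6 hlk
    obtain ⟨l, rfl⟩ : ∃ i, l = i + 1 := ⟨l - 1, by omega⟩
    obtain ⟨p, hp, hl⟩ := hpath u v l (by omega) (by omega)
      (by rintro rfl; exact hA Iff.rfl) (by
        rw [Nat.even_add_one] at hle
        exact iff_of_false hle hA)
    exact ⟨p, hp, by rw [hl]⟩

lemma isDenseCore_of_minDegree {X : Finset V} {A : Set V} {d M : ℕ}
    (hbip : ∀ x ∈ X, ∀ y ∈ X, G.Adj x y → (x ∈ A ↔ y ∉ A))
    (hd : ∀ v ∈ X, d ≤ (G.nbrsIn X v).card) (hM : M ≤ d) (hMd : M + X.card ≤ 3 * d) :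
    G.IsDenseCore X A M := by
  classical
  refine ⟨hbip, fun x hx => hM.trans (hd x hx), fun u hu v hv _ huv => ?_⟩
  rcases (G.nbrsIn X u).eq_empty_or_nonempty with h0 | ⟨y, hy⟩
  · have := hd u hu
    rw [h0, Finset.card_empty] at this
    omega
  rw [mem_nbrsIn] at hy
  have hdisj : Disjoint (G.nbrsIn X u ∪ G.nbrsIn X v) (G.nbrsIn X y) := by
    rw [Finset.disjoint_left]
    intro a ha ha'
    simp only [Finset.mem_union, mem_nbrsIn] at ha ha'
    have h1 := hbip u hu y hy.1 hy.2
    have h2 := hbip y hy.1 a ha'.1 ha'.2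
    rcases ha with ha | ha
    · have := hbip u hu a ha.1 ha.2
      tauto
    · have := hbip v hv a ha.1 ha.2
      tauto
  have hle : ((G.nbrsIn X u ∪ G.nbrsIn X v) ∪ G.nbrsIn X y).card ≤ X.card :=
    Finset.card_le_card (Finset.union_subset (Finset.union_subset (nbrsIn_subset _ _)
      (nbrsIn_subset _ _)) (nbrsIn_subset _ _))
  rw [Finset.card_union_of_disjoint hdisj] at hle
  have := Finset.card_union_add_card_inter (G.nbrsIn X u) (G.nbrsIn X v)
  have := hd u hu
  have := hd v hv
  have := hd y hy.1
  omega

/-- In a graph without `(2k+1)`-cycles, the bipartition of a dense core extends to any set of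
vertices having at least two neighbours in the core. -/
lemma IsDenseCore.exists_bipartition_superset {X S : Finset V} {A : Set V} {M k : ℕ}
    (h : G.IsDenseCore X A M) (hk : 2 ≤ k) (hM : 2 * k ≤ M) (hfree : G.CycleFree (2 * k + 1))
    (htwo : ∀ v ∈ S, 2 ≤ (G.nbrsIn X v).card) :
    ∃ B : Set V, G.IsDenseCore X B M ∧ ∀ x ∈ S, ∀ y ∈ S, G.Adj x y → (x ∈ B ↔ y ∉ B) := by
  classical
  set B : Set V := {v | if v ∈ X then v ∈ A else ∃ w ∈ X, G.Adj v w ∧ w ∉ A} with hB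
  have hBX : ∀ v ∈ X, (v ∈ B ↔ v ∈ A) := fun v hv => by simp [hB, hv]
  have hBn : ∀ v ∉ X, (v ∈ B ↔ ∃ w ∈ X, G.Adj v w ∧ w ∉ A) := fun v hv => by simp [hB, hv]
  have hcore : G.IsDenseCore X B M := by
    refine ⟨fun x hx y hy hxy => ?_, h.le_deg, fun u hu v hv huv hA => ?_⟩
    · rw [hBX x hx, hBX y hy]
      exact h.bip x hx y hy hxy
    · rw [hBX u hu, hBX v hv] at hA
      exact h.le_codeg u hu v hv huv hA
  have hout : ∀ v ∉ X, ∀ w ∈ X, G.Adj v w → (v ∈ B ↔ w ∉ B) := by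
    intro v hv w hw hvw
    rw [hBn v hv, hBX w hw]
    refine ⟨?_, fun hwA => ⟨w, hw, hvw, hwA⟩⟩
    rintro ⟨u, hu, hvu, huA⟩ hwA
    obtain ⟨m, rfl⟩ : ∃ i, k = i + 2 := ⟨k - 2, by omega⟩
    have hp := h.hasPathIn ∅ (l := 2 * m + 3) (by omega) (by simp; omega) hu hw (by simp)
      (by simp) (by rintro rfl; exact huA hwA) (by
        refine iff_of_false ?_ (by tauto)
        rw [Nat.even_iff]
        omega)
    exact (hp.cons hvu (by simp [hv])).not_adj (by omega) hfree hvw.symm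
  have hoo : ∀ v ∈ S, v ∉ X → ∀ w ∈ S, w ∉ X → G.Adj v w → ¬ (v ∈ B ↔ w ∈ B) := by
    intro v hvS hv w hwS hw hvw hvwB
    obtain ⟨a, ha⟩ := Finset.card_pos.1 (lt_of_lt_of_le (by omega) (htwo v hvS))
    obtain ⟨b, hb, hba⟩ := Finset.exists_mem_ne (htwo w hwS) a
    rw [mem_nbrsIn] at ha hb
    have h1 := hout v hv a ha.1 ha.2
    have h2 := hout w hw b hb.1 hb.2
    obtain ⟨m, rfl⟩ : ∃ i, k = i + 2 := ⟨k - 2, by omega⟩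
    have hp := hcore.hasPathIn ∅ (l := 2 * m + 2) (by omega) (by simp; omega) ha.1 hb.1
      (by simp) (by simp) hba.symm (by
        refine iff_of_true ?_ (by tauto)
        rw [Nat.even_iff]
        omega)
    have hp' := (hp.cons ha.2 (by simp [hv])).cons hvw.symm (by simp [hw, hvw.ne'])
    exact hp'.not_adj (by omega) hfree hb.2.symm
  refine ⟨B, hcore, fun x hx y hy hxy => ?_⟩
  by_cases hxX : x ∈ X <;> by_cases hyX : y ∈ X
  · exact hcore.bip x hxX y hyX hxy
  · have := hout y hyX x hxX hxy.symm
    tauto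
  · exact hout x hxX y hyX hxy
  · have := hoo x hx hxX y hy hyX hxy
    tauto

lemma card_nbrsIn_le_add_sdiff [DecidableEq V] (X S : Finset V) (v : V) :
    (G.nbrsIn S v).card ≤ (G.nbrsIn X v).card + (S \ X).card := by
  refine (Finset.card_le_card fun w hw => ?_).trans (Finset.card_union_le _ _)
  simp only [Finset.mem_union, mem_nbrsIn, Finset.mem_sdiff] at hw ⊢
  tauto

lemma ncard_neighborSet_inter (S : Finset V) (v : V) :
    (G.neighborSet v ∩ S).ncard = (G.nbrsIn S v).card := by
  rw [← Set.ncard_coe_finset]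
  congr 1
  ext w
  simp [and_comm]

lemma ncard_neighborSet_induce {S : Finset V} {v : V} (hv : v ∈ S) :
    (((⊤ : G.Subgraph).induce (S : Set V)).neighborSet v).ncard = (G.nbrsIn S v).card := by
  rw [← Set.ncard_coe_finset]
  congr 1
  ext w
  simp [hv]

end SimpleGraph

/-- Lemma 3.2: existence of `k`-dense bipartite subgraphs. Let
`c, k ≥ 2` and `n ≥ max {50c, 50k}`. If `G` is an `n`-vertex `C_{2k+1}`-free graph with
`e(G) ≥ (n-c)²/4`, then `G` contains subgraphs `F ⊆ G'` such that:
(a) `|V(F)| ≥ n - 10c`, every vertex of `F` has more than `2n/5` neighbours in `F`, and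
every vertex outside `F` has at most `2n/5` neighbours in `V(F)`;
(b) `|V(G')| ≥ n - 2c`, every vertex of `G'` has at least `11c` neighbours in `G'`, and
every vertex outside `G'` has fewer than `11c` neighbours in `V(G')`;
(c) both `F` and `G'` are `k`-dense bipartite subgraphs of `G`. -/
theorem stmt_9 (c k n : ℕ) (hc : 2 ≤ c) (hk : 2 ≤ k) (hn1 : 50 * c ≤ n)
    (hn2 : 50 * k ≤ n) (G : SimpleGraph (Fin n))
    (hfree : G.CycleFree (2 * k + 1))
    (he : ((n : ℝ) - c) ^ 2 / 4 ≤ (G.edgeSet.ncard : ℝ)) :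
    ∃ F G' : G.Subgraph, F ≤ G' ∧
      (n - 10 * c ≤ F.verts.ncard ∧
        (∀ v ∈ F.verts, 2 * n < 5 * (F.neighborSet v).ncard) ∧
        (∀ v : Fin n, v ∉ F.verts → 5 * (G.neighborSet v ∩ F.verts).ncard ≤ 2 * n)) ∧
      (n - 2 * c ≤ G'.verts.ncard ∧
        (∀ v ∈ G'.verts, 11 * c ≤ (G'.neighborSet v).ncard) ∧
        (∀ v : Fin n, v ∉ G'.verts → (G.neighborSet v ∩ G'.verts).ncard < 11 * c)) ∧
      KDenseBip k F.coe ∧ KDenseBip k G'.coe := by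
  classical
  have hE : ((n : ℤ) - c) ^ 2 ≤ 4 * G.edgeSet.ncard := by
    have : ((n : ℝ) - c) ^ 2 ≤ 4 * G.edgeSet.ncard := by linarith
    exact_mod_cast this
  obtain ⟨X₀, hX₀c, hX₀⟩ : ∃ S : Finset (Fin n), n < S.card + 10 * c ∧
      ∀ v ∈ S, 2 * n / 5 < (G.nbrsIn S v).card := by
    rcases G.exists_large_minDegree_or (2 * n / 5) (10 * c) (by simp; omega) with
      ⟨S, hS, hd⟩ | ⟨S, hS, hsum⟩
    · exact ⟨S, by simpa using hS, hd⟩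
    · exfalso
      rw [Fintype.card_fin] at hS
      have h1 := hfree.two_mul_sum_card_nbrsIn_le hk S (by omega)
      have h2 : 5 * (2 * n / 5) ≤ 2 * n := Nat.mul_div_le _ _
      generalize 2 * n / 5 = d at *
      generalize ∑ w ∈ S, (G.nbrsIn S w).card = D at *
      have hS' : (S.card : ℤ) = n - 10 * c := by omega
      zify at hsum h1 h2 hn1 hc
      rw [hS'] at h1
      nlinarith
  obtain ⟨S₀, hS₀c, hS₀⟩ : ∃ S : Finset (Fin n), n < S.card + 2 * c ∧
      ∀ v ∈ S, 11 * c - 1 < (G.nbrsIn S v).card := by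
    rcases G.exists_large_minDegree_or (11 * c - 1) (2 * c) (by simp; omega) with
      ⟨S, hS, hd⟩ | ⟨S, hS, hsum⟩
    · exact ⟨S, by simpa using hS, hd⟩
    · exfalso
      rw [Fintype.card_fin] at hS
      have h1 := hfree.two_mul_sum_card_nbrsIn_le hk S (by omega)
      have h2 : 11 * c - 1 ≤ 11 * c := by omega
      generalize 11 * c - 1 = d at *
      generalize ∑ w ∈ S, (G.nbrsIn S w).card = D at *
      have hS' : (S.card : ℤ) = n - 2 * c := by omega
      zify at hsum h1 h2 hn1 hc
      rw [hS'] at h1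
      nlinarith
  obtain ⟨X, hX₀X, hXd, hXmax⟩ := SimpleGraph.exists_maximal_minDegree hX₀
  have hXle : X.card ≤ n := by simpa using X.card_le_univ
  have hXc := Finset.card_le_card hX₀X
  obtain ⟨A, hA⟩ := G.exists_bipartition (X := X)
    (fun v hv => by
      have := hXd v hv
      omega)
    (fun a ha b hb e he hab hbe hea => hfree.not_triangle (by omega) hXd (by omega)
      ha hb he hab hbe hea)
  have hcore : G.IsDenseCore X A (10 * k) :=
    SimpleGraph.isDenseCore_of_minDegree hA hXd (by omega) (by omega)
  obtain ⟨S, hS₀S, hSd, hSmax⟩ := SimpleGraph.exists_maximal_minDegree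
    (G := G) (d := 11 * c - 1) (S₀ := S₀ ∪ X) (fun v hv => by
      rcases Finset.mem_union.1 hv with hv | hv
      · exact (hS₀ v hv).trans_le
          (Finset.card_le_card (G.nbrsIn_mono Finset.subset_union_left v))
      · have := hXd v hv
        have := Finset.card_le_card
          (G.nbrsIn_mono (Finset.subset_union_right (s₁ := S₀) (s₂ := X)) v)
        omega)
  have hXS : X ⊆ S := Finset.subset_union_right.trans hS₀S
  have hSc := Finset.card_le_card (Finset.subset_union_left.trans hS₀S)
  have hSle : S.card ≤ n := by simpa using S.card_le_univ
  have hthree : ∀ v ∈ S, 3 ≤ (G.nbrsIn X v).card := by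
    intro v hv
    have := hSd v hv
    have := G.card_nbrsIn_le_add_sdiff X S v
    rw [Finset.card_sdiff_of_subset hXS] at this
    omega
  obtain ⟨B, hcoreB, hB⟩ := hcore.exists_bipartition_superset hk (by omega) hfree
    (fun v hv => (hthree v hv).trans' (by omega))
  refine ⟨(⊤ : G.Subgraph).induce X, (⊤ : G.Subgraph).induce S,
    SimpleGraph.Subgraph.induce_mono_right (by exact_mod_cast hXS),
    ⟨?_, fun v hv => ?_, fun v hv => ?_⟩, ⟨?_, fun v hv => ?_, fun v hv => ?_⟩, ?_, ?_⟩
  · rw [SimpleGraph.Subgraph.induce_verts, Set.ncard_coe_finset]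
    omega
  · rw [SimpleGraph.ncard_neighborSet_induce hv]
    have := hXd v hv
    omega
  · rw [SimpleGraph.Subgraph.induce_verts, SimpleGraph.ncard_neighborSet_inter]
    have := hXmax v hv
    omega
  · rw [SimpleGraph.Subgraph.induce_verts, Set.ncard_coe_finset]
    omega
  · rw [SimpleGraph.ncard_neighborSet_induce hv]
    have := hSd v hv
    omega
  · rw [SimpleGraph.Subgraph.induce_verts, SimpleGraph.ncard_neighborSet_inter]
    have := hSmax v hv
    omega
  · rw [← SimpleGraph.induce_eq_coe_induce_top]
    exact hcore.kDenseBip hk (by omega) subset_rfl (by omega) hA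
      (fun v hv => hthree v (hXS hv))
  · rw [← SimpleGraph.induce_eq_coe_induce_top]
    exact hcoreB.kDenseBip hk (by omega) hXS (by omega) hB hthree
end

section
/- Let G be a simple graph, let G' be a 2-connected bipartite subgraph of G with bipartition (X, Y), and let B be a 2-connected subgraph of G that contains G' as a subgraph. If B is not bipartite, then B contains a bad path for G'; that is, there exist vertices u, v ∈ V(G') and a path in B from u to v, all of whose internal vertices lie in V(B)∖V(G'), which has odd length (odd number of edges) if u and v lie in the same part of G', and even length if u and v lie in different parts of G'. -/
namespace SimpleGraph

variable {W : Type*} {H : SimpleGraph W}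

/-- Two paths sharing only the joining vertex concatenate to a path. -/
theorem Walk.IsPath.append_of_inter {u v w : W} {p : H.Walk u v} {q : H.Walk v w}
    (hp : p.IsPath) (hq : q.IsPath) (h : ∀ x ∈ p.support, x ∈ q.support → x = v) :
    (p.append q).IsPath := by
  rw [Walk.isPath_def, Walk.support_append, List.nodup_append']
  refine ⟨hp.support_nodup, hq.support_nodup.tail, fun x hx hx' => ?_⟩
  obtain rfl := h x hx (List.mem_of_mem_tail hx')
  have hnd := hq.support_nodup
  rw [← Walk.cons_tail_support] at hnd
  exact (List.nodup_cons.mp hnd).1 hx'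

theorem Walk.IsPath.eq_of_mem_takeUntil_of_mem_dropUntil [DecidableEq W] {u v w x : W}
    {p : H.Walk u v} (hp : p.IsPath) (hw : w ∈ p.support)
    (h₁ : x ∈ (p.takeUntil w hw).support) (h₂ : x ∈ (p.dropUntil w hw).support) : x = w := by
  by_contra hne
  rw [← p.take_spec hw, Walk.isPath_def, Walk.support_append, List.nodup_append'] at hp
  rw [← Walk.cons_tail_support] at h₂
  exact hp.2.2 h₁ ((List.mem_cons.mp h₂).resolve_left hne)

/-- A walk from `A` to `T` contains a path from `A` to `T` meeting these sets only in its ends. -/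
theorem Walk.exists_isPath_between {A T : Set W} {a t : W} (q : H.Walk a t)
    (ha : a ∈ A) (ht : t ∈ T) :
    ∃ a' ∈ A, ∃ t' ∈ T, ∃ r : H.Walk a' t', r.IsPath ∧ r.support ⊆ q.support ∧
      (∀ x ∈ r.support, x ∈ A → x = a') ∧ ∀ x ∈ r.support, x ∈ T → x = t' := by
  classical
  induction hn : q.length using Nat.strong_induction_on generalizing a t with
  | _ n ih =>
    by_cases hA : ∃ x ∈ q.support, x ∈ A ∧ x ≠ a
    · obtain ⟨x, hx, hxA, hne⟩ := hA
      obtain ⟨a', ha', t', ht', r, hr, hs, h⟩ :=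
        ih _ (hn ▸ q.length_dropUntil_lt_length hx hne) (q.dropUntil x hx) hxA ht rfl
      exact ⟨a', ha', t', ht', r, hr, fun y hy => q.support_dropUntil_subset_support hx (hs hy), h⟩
    by_cases hT : ∃ x ∈ q.support, x ∈ T ∧ x ≠ t
    · obtain ⟨x, hx, hxT, hne⟩ := hT
      obtain ⟨a', ha', t', ht', r, hr, hs, h⟩ :=
        ih _ (hn ▸ q.length_takeUntil_lt_length hx hne) (q.takeUntil x hx) ha hxT rfl
      exact ⟨a', ha', t', ht', r, hr, fun y hy => q.support_takeUntil_subset_support hx (hs hy), h⟩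
    push Not at hA hT
    exact ⟨a, ha, t, ht, q.bypass, q.bypass_isPath, q.support_bypass_subset_support,
      fun x hx => hA x (q.support_bypass_subset_support hx),
      fun x hx => hT x (q.support_bypass_subset_support hx)⟩

/-- Every path with distinct ends in `S` and interior outside `S` has the parity
prescribed by the colouring `c`. -/
def PathsRespect (H : SimpleGraph W) (S : Set W) (c : W → ℕ) : Prop :=
  ∀ ⦃u v : W⦄, u ∈ S → v ∈ S → u ≠ v → ∀ p : H.Walk u v, p.IsPath →
    (∀ x ∈ p.support, x ≠ u → x ≠ v → x ∉ S) → Even (p.length + c u + c v)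

/-- In a 2-connected graph, a cycle through exactly one vertex `s` of `S` is even. -/
theorem PathsRespect.odd_length {S : Set W} {c : W → ℕ} (hc : H.PathsRespect S c)
    (hH : ∀ v : W, (H.induce (({v} : Set W)ᶜ)).Connected) (hS : S.Nontrivial)
    {s v : W} (hs : s ∈ S) (hsv : H.Adj s v) {p : H.Walk v s} (hp : p.IsPath)
    (hint : ∀ x ∈ p.support, x ≠ s → x ∉ S) : Odd p.length := by
  classical
  obtain ⟨t₀, ht₀, hts₀⟩ := hS.exists_ne s
  obtain ⟨q₀⟩ := (hH s).preconnected ⟨v, hsv.ne'⟩ ⟨t₀, hts₀⟩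
  set q := q₀.map (Embedding.induce _).toHom with hq
  have hsq : s ∉ q.support := by
    rw [hq, Walk.support_map, List.mem_map]
    rintro ⟨x, -, hx⟩
    exact x.2 hx
  obtain ⟨w, ⟨hwp, hws⟩, t, ⟨ht, hts⟩, r, hr, hrs, hrA, hrT⟩ :=
    q.exists_isPath_between (A := {x | x ∈ p.support ∧ x ≠ s}) (T := {x | x ∈ S ∧ x ≠ s})
      ⟨p.start_mem_support, hsv.ne'⟩ ⟨ht₀, hts₀⟩
  have hsr : s ∉ r.support := fun h => hsq (hrs h)
  have hrp : ∀ x ∈ r.support, x ∈ p.support → x = w := fun x hx hxp =>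
    hrA x hx ⟨hxp, fun h => hsr (h ▸ hx)⟩
  have hrS : ∀ x ∈ r.support, x ≠ t → x ∉ S := fun x hx hxt hxS =>
    hxt (hrT x hx ⟨hxS, fun h => hsr (h ▸ hx)⟩)
  have hp₁ : ∀ x ∈ (p.takeUntil w hwp).support, x ∈ p.support :=
    fun x hx => p.support_takeUntil_subset_support hwp hx
  have hp₂ : ∀ x ∈ (p.dropUntil w hwp).support, x ∈ p.support :=
    fun x hx => p.support_dropUntil_subset_support hwp hx
  have hs₁ : s ∉ (p.takeUntil w hwp).support := fun h =>
    hws (hp.eq_of_mem_takeUntil_of_mem_dropUntil hwp h (Walk.end_mem_support _)).symm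
  have e₁ := hc hs ht (Ne.symm hts) (.cons hsv ((p.takeUntil w hwp).append r))
    (by
      refine ((hp.takeUntil hwp).append_of_inter hr fun x hx hxr => hrp x hxr (hp₁ x hx)).cons ?_
      simp [Walk.mem_support_append_iff, hs₁, hsr])
    (by
      intro x hx hxs hxt
      simp only [Walk.support_cons, List.mem_cons, Walk.mem_support_append_iff] at hx
      rcases hx with hx | hx | hx
      · exact absurd hx hxs
      · exact hint x (hp₁ x hx) hxs
      · exact hrS x hx hxt)
  have e₂ := hc hs ht (Ne.symm hts) ((p.dropUntil w hwp).reverse.append r)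
    ((hp.dropUntil hwp).reverse.append_of_inter hr fun x hx hxr =>
      hrp x hxr (hp₂ x (by simpa using hx)))
    (by
      intro x hx hxs hxt
      simp only [Walk.mem_support_append_iff, Walk.support_reverse, List.mem_reverse] at hx
      rcases hx with hx | hx
      · exact hint x (hp₂ x hx) hxs
      · exact hrS x hx hxt)
  have hl := congrArg Walk.length (p.take_spec hwp)
  simp only [Walk.length_append, Walk.length_cons, Walk.length_reverse] at hl e₁ e₂
  rw [Nat.even_iff] at e₁ e₂
  rw [Nat.odd_iff]
  omega

theorem PathsRespect.insert_update [DecidableEq W] {S : Set W} {c : W → ℕ} (hc : H.PathsRespect S c)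
    (hH : ∀ v : W, (H.induce (({v} : Set W)ᶜ)).Connected) (hS : S.Nontrivial)
    {s v : W} (hs : s ∈ S) (hv : v ∉ S) (hsv : H.Adj s v) :
    H.PathsRespect (insert v S) (Function.update c v (c s + 1)) := by
  have key : ∀ t ∈ S, ∀ p : H.Walk v t, p.IsPath →
      (∀ x ∈ p.support, x ≠ v → x ≠ t → x ∉ insert v S) → Even (p.length + (c s + 1) + c t) := by
    intro t ht p hp hint
    have hint' : ∀ x ∈ p.support, x ≠ t → x ∉ S := fun x hx hxt hxS => by
      have hxv : x ≠ v := fun h => hv (h ▸ hxS)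
      exact hint x hx hxv hxt (Set.mem_insert_of_mem _ hxS)
    by_cases hts : t = s
    · subst hts
      have := hc.odd_length hH hS hs hsv hp hint'
      rw [Nat.odd_iff] at this
      rw [Nat.even_iff]
      omega
    · have := hc hs ht (Ne.symm hts) (.cons hsv p)
        (hp.cons fun h => hint' s h (Ne.symm hts) hs)
        (by
          intro x hx hxs hxt
          rw [Walk.support_cons, List.mem_cons] at hx
          exact hint' x (hx.resolve_left hxs) hxt)
      rw [Walk.length_cons, Nat.even_iff] at this
      rw [Nat.even_iff]
      omega
  intro u w hu hw huw p hp hint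
  rcases Set.mem_insert_iff.mp hu with rfl | huS
  · have hwS := (Set.mem_insert_iff.mp hw).resolve_left (Ne.symm huw)
    rw [Function.update_self, Function.update_of_ne (Ne.symm huw)]
    exact key w hwS p hp hint
  rcases Set.mem_insert_iff.mp hw with rfl | hwS
  · rw [Function.update_self, Function.update_of_ne huw]
    have := key u huS p.reverse hp.reverse (by
      intro x hx h₁ h₂
      exact hint x (by simpa using hx) h₂ h₁)
    rw [Walk.length_reverse, Nat.even_iff] at this
    rw [Nat.even_iff]
    omega
  · rw [Function.update_of_ne (ne_of_mem_of_not_mem huS hv),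
      Function.update_of_ne (ne_of_mem_of_not_mem hwS hv)]
    exact hc huS hwS huw p hp fun x hx h₁ h₂ h => hint x hx h₁ h₂ (Set.mem_insert_of_mem _ h)

/-- If the paths through the complement of `S` respect some colouring of `S`, then a finite
2-connected graph is bipartite. -/
theorem PathsRespect.exists_coloring [Finite W] {S : Set W} {c : W → ℕ}
    (hc : H.PathsRespect S c) (hconn : H.Connected)
    (hH : ∀ v : W, (H.induce (({v} : Set W)ᶜ)).Connected) (hS : S.Nontrivial) :
    ∃ c' : W → ℕ, ∀ ⦃x y : W⦄, H.Adj x y → Odd (c' x + c' y) := by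
  classical
  induction hn : Sᶜ.ncard using Nat.strong_induction_on generalizing S c with
  | _ n ih =>
    by_cases hne : ∃ z, z ∉ S
    · obtain ⟨z, hz⟩ := hne
      obtain ⟨s₀, hs₀⟩ := hS.nonempty
      obtain ⟨q⟩ := hconn.preconnected s₀ z
      obtain ⟨d, -, hs, hv⟩ := q.exists_boundary_dart S hs₀ hz
      refine ih _ ?_ (hc.insert_update hH hS hs hv d.adj) (hS.mono (Set.subset_insert _ _)) rfl
      rw [← hn]
      refine Set.ncard_lt_ncard ?_ (Set.toFinite _)
      exact compl_lt_compl_iff_lt.mpr (Set.ssubset_insert hv)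
    · push Not at hne
      refine ⟨c, fun x y hxy => ?_⟩
      have := hc (hne x) (hne y) hxy.ne hxy.toWalk (by simpa using! hxy.ne)
        (by
          intro w hw h₁ h₂
          simp at hw
          tauto)
      simp only [Walk.length_cons, Walk.length_nil, Nat.even_iff] at this
      rw [Nat.odd_iff]
      omega

end SimpleGraph

/-- Lemma 3.4: bad paths. Let `G'` be a 2-connected bipartite subgraph
of `G` with bipartition `(X, Y)`, and let `B` be a 2-connected subgraph of `G` containing
`G'`. If `B` is not bipartite, then `B` contains a bad path for `G'`: a path whose
endpoints lie in `V(G')`, all of whose internal vertices lie outside `V(G')`, of odd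
length if the endpoints are in the same part of `G'` and of even length otherwise. -/
theorem stmt_10 {V : Type*} [Fintype V] (G : SimpleGraph V) (G' B : G.Subgraph)
    (hGB : G' ≤ B) (X Y : Set V) (hXY : X ∪ Y = G'.verts) (hdisj : Disjoint X Y)
    (hbip : ∀ ⦃x y : V⦄, G'.Adj x y → (x ∈ X ∧ y ∈ Y) ∨ (x ∈ Y ∧ y ∈ X))
    (h2G' : G'.coe.TwoConnected) (h2B : B.coe.TwoConnected)
    (hnotbip : ¬ ∃ A : Set V, ∀ ⦃x y : V⦄, B.Adj x y →
        ((x ∈ A ∧ y ∉ A) ∨ (x ∉ A ∧ y ∈ A))) :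
    ∃ (u v : B.verts), (u : V) ∈ G'.verts ∧ (v : V) ∈ G'.verts ∧
      ∃ p : B.coe.Walk u v, p.IsPath ∧
        (∀ w ∈ p.support, w ≠ u → w ≠ v → (w : V) ∉ G'.verts) ∧
        (((u : V) ∈ X ↔ (v : V) ∈ X) → Odd p.length) ∧
        (¬((u : V) ∈ X ↔ (v : V) ∈ X) → Even p.length) := by
  classical
  by_contra hbad
  have hc : B.coe.PathsRespect {x | (x : V) ∈ G'.verts}
      (fun x => if (x : V) ∈ X then 1 else 0) := by
    intro u v hu hv huv p hp hint
    by_contra hpar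
    refine hbad ⟨u, v, hu, hv, p, hp, hint, fun h => ?_, fun h => ?_⟩
    all_goals
      simp only [Nat.odd_iff, Nat.even_iff] at hpar ⊢
      by_cases hux : (u : V) ∈ X <;> by_cases hvx : (v : V) ∈ X <;> simp [hux, hvx] at h hpar <;>
        omega
  have hS : ({x | (x : V) ∈ G'.verts} : Set B.verts).Nontrivial := by
    have : Nontrivial G'.verts := Finite.one_lt_card_iff_nontrivial.mp (by have := h2G'.1; omega)
    obtain ⟨x, y, hxy⟩ := exists_pair_ne G'.verts
    exact ⟨⟨x, hGB.1 x.2⟩, x.2, ⟨y, hGB.1 y.2⟩, y.2,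
      fun h => hxy (Subtype.ext (Subtype.mk.inj h))⟩
  obtain ⟨c, hcol⟩ := hc.exists_coloring h2B.2.1 h2B.2.2 hS
  refine hnotbip ⟨{x | ∃ h : x ∈ B.verts, Even (c ⟨x, h⟩)}, fun x y hxy => ?_⟩
  have hx := hxy.fst_mem
  have hy := hxy.snd_mem
  have := hcol (x := ⟨x, hx⟩) (y := ⟨y, hy⟩) hxy
  rw [Nat.odd_add] at this
  simp only [Set.mem_ofPred_eq, hx, hy, exists_true_left, ← Nat.not_odd_iff_even] at this ⊢
  tauto
end

section
/- Let r ≥ 3 and let G be an n-vertex simple graph belonging to the family 𝒢_{n,r}. Then the chromatic number of G satisfies χ(G) ≤ r−1; that is, G admits a proper vertex coloring with r−1 colors. -/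
/-- If `r ≥ 3` and `G ∈ 𝒢_{n,r}`, then `G` is properly colorable with
`r - 1` colors, i.e. `χ(G) ≤ r - 1`. -/
theorem stmt_11 (n r : ℕ) (hr3 : 3 ≤ r) (G : SimpleGraph (Fin n))
    (hG : FamilyG n r G) : G.Colorable (r - 1) := by
  classical
  obtain ⟨s, W, v, hdisj, hcard, -, ⟨A, hA⟩, hW, hvW⟩ := hG
  set U : Finset (Fin n) := Finset.univ.biUnion W with hU
  have hmem : ∀ x ∈ U, ∃ i, x ∈ W i := fun x hx => by simpa [hU] using hx
  obtain ⟨f, hf, hinj⟩ : ∃ f : Fin n → ℕ, (∀ x ∈ U, f x < r - 2) ∧ Set.InjOn f U := by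
    refine ⟨fun x => if hx : x ∈ U then U.equivFin ⟨x, hx⟩ else 0, fun x hx => ?_,
      fun x hx y hy hxy => ?_⟩
    · simp only [hx, dif_pos]
      exact lt_of_lt_of_le (Fin.is_lt _) hcard
    · rw [Finset.mem_coe] at hx hy
      simp only [hx, hy, dif_pos] at hxy
      simpa using U.equivFin.injective (Fin.ext hxy)
  have hattach : ∀ x, ∃ w, ∀ i, x ∈ W i → w = v i := fun x => by
    by_cases hx : ∃ i, x ∈ W i
    · obtain ⟨i, hi⟩ := hx
      refine ⟨v i, fun j hj => ?_⟩
      by_contra hne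
      exact Finset.disjoint_left.mp (hdisj i j fun h => hne (congrArg v h)) hi hj
    · exact ⟨x, fun i hi => absurd ⟨i, hi⟩ hx⟩
  choose q hq using hattach
  let b : Fin n → ℕ := fun x => if x ∈ A then 0 else 1
  let c : Fin n → ℕ := fun x =>
    if x ∈ U then (if q x ∈ A then f x + 1 else if f x = 0 then 0 else f x + 1) else b x
  have hlt : ∀ x, c x < r - 1 := fun x => by
    have := hf x
    grind
  have hmixed : ∀ x y, G.Adj x y → x ∈ U → y ∉ U → c x ≠ c y := fun x y hxy hx hy => by
    obtain ⟨i, hi⟩ := hmem x hx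
    have := hvW i x hi y hxy hy
    have := hq x i hi
    grind
  refine ⟨SimpleGraph.Coloring.mk (fun x => (⟨c x, hlt x⟩ : Fin (r - 1))) ?_⟩
  intro x y hxy heq
  replace heq : c x = c y := congrArg Fin.val heq
  by_cases hx : x ∈ U <;> by_cases hy : y ∈ U
  · obtain ⟨i, hi⟩ := hmem x hx
    obtain ⟨j, hj⟩ := hmem y hy
    have hij : i = j := by
      by_contra hne
      exact hW i j hne x hi y hj hxy
    have hqxy : q x = q y := by rw [hq x i hi, hq y j hj, hij]
    have hfxy : f x = f y := by grind
    exact hxy.ne (hinj hx hy hfxy)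
  · exact hmixed x y hxy hx hy heq
  · exact hmixed y x hxy.symm hy hx heq.symm
  · have := hA x y hxy hx hy
    grind
end

section
/- Let k ≥ 2 and let H be a C_{2k+1}-free simple graph on N vertices with N ≥ 5k whose minimum degree exceeds 2N/5. Then H is bipartite. -/
namespace SimpleGraph

variable {V : Type*} {G : SimpleGraph V}

/-- The list `l` enumerates, in cyclic order, distinct vertices such that cyclically consecutive
ones are adjacent in `G`. -/
def IsCycleList (G : SimpleGraph V) (l : List V) : Prop :=
  l.Nodup ∧ (l : Cycle V).Chain G.Adj

theorem isCycleList_cons {a : V} {l : List V} :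
    G.IsCycleList (a :: l) ↔ (a :: l).Nodup ∧ (a :: (l ++ [a])).IsChain G.Adj := by
  rw [IsCycleList, Cycle.chain_coe_cons]

theorem IsCycleList.isRotated {l l' : List V} (h : G.IsCycleList l) (hr : l ~r l') :
    G.IsCycleList l' :=
  ⟨hr.nodup_iff.1 h.1, by rw [← Cycle.coe_eq_coe.2 hr]; exact h.2⟩

theorem IsCycleList.exists_isCycle {l : List V} (h : G.IsCycleList l) (hl : 3 ≤ l.length) :
    ∃ (v : V) (w : G.Walk v v), w.IsCycle ∧ w.length = l.length := by
  obtain _ | ⟨a, t⟩ := l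
  · simp at hl
  obtain ⟨hn, hc⟩ := isCycleList_cons.1 h
  obtain ⟨w, hw⟩ : ∃ w : G.Walk a a, w.support = a :: (t ++ [a]) := by
    have hne : a :: (t ++ [a]) ≠ [] := by simp
    have hlast : (a :: (t ++ [a])).getLast hne = a := by simp
    exact ⟨(Walk.ofSupport _ hne hc).copy rfl hlast,
      (Walk.support_copy _ _ _).trans (Walk.support_ofSupport hne hc)⟩
  have hlen : w.length = t.length + 1 := by simpa [hw] using w.length_support.symm
  refine ⟨a, w, ?_, hlen⟩
  rw [Walk.isCycle_iff_isPath_tail_and_le_length]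
  refine ⟨?_, by simpa [hlen] using hl⟩
  rw [Walk.isPath_def, Walk.support_tail_of_not_nil _ (by rw [Walk.not_nil_iff_lt_length]; omega),
    hw]
  exact (List.perm_append_singleton a t).nodup_iff.2 hn

theorem IsCycleList.insert_two {a b x y : V} {t : List V} (h : G.IsCycleList (a :: b :: t))
    (hx : x ∉ a :: b :: t) (hy : y ∉ a :: b :: t) (hax : G.Adj a x) (hxy : G.Adj x y)
    (hyb : G.Adj y b) : G.IsCycleList (a :: x :: y :: b :: t) := by
  rw [isCycleList_cons] at *
  have := hxy.ne
  simp_all [eq_comm]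

theorem IsCycleList.replace_two {a b c x y z : V} {t : List V}
    (h : G.IsCycleList (a :: b :: c :: t)) (hx : x ∉ a :: b :: c :: t) (hy : y ∉ a :: b :: c :: t)
    (hz : z ∉ a :: b :: c :: t) (hxy : x ≠ y) (hax : G.Adj a x) (hxz : G.Adj x z)
    (hzy : G.Adj z y) (hyc : G.Adj y c) : G.IsCycleList (a :: x :: z :: y :: c :: t) := by
  rw [isCycleList_cons] at *
  have := hxz.ne
  have := hzy.ne
  simp_all [eq_comm]

theorem IsCycleList.replace_four {a b c d e x y z u v : V} {t : List V}
    (h : G.IsCycleList (a :: b :: c :: d :: e :: t)) (hx : x ∉ a :: b :: c :: d :: e :: t)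
    (hy : y ∉ a :: b :: c :: d :: e :: t) (hz : z ∉ a :: b :: c :: d :: e :: t)
    (hu : u ∉ a :: b :: c :: d :: e :: t) (hv : v ∉ a :: b :: c :: d :: e :: t)
    (hn : [x, u, z, v, y].Nodup) (hax : G.Adj a x) (hxu : G.Adj x u) (huz : G.Adj u z)
    (hzv : G.Adj z v) (hvy : G.Adj v y) (hye : G.Adj y e) :
    G.IsCycleList (a :: x :: u :: z :: v :: y :: e :: t) := by
  rw [isCycleList_cons] at *
  simp_all [eq_comm]

theorem IsCycleList.insert_insert {a b e f w w' : V} {t l₁ l₂ : List V}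
    (h : G.IsCycleList (a :: b :: t)) (hw : w ∉ a :: b :: t) (hw' : w' ∉ a :: b :: t)
    (hne : w ≠ w') (haw : G.Adj a w) (hwb : G.Adj w b) (hs : b :: t ++ [a] = l₁ ++ e :: f :: l₂)
    (hew : G.Adj e w') (hwf : G.Adj w' f) : G.IsCycleList (w :: (l₁ ++ e :: w' :: f :: l₂)) := by
  rw [isCycleList_cons] at *
  have hperm : (a :: b :: t).Perm (l₁ ++ e :: f :: l₂) :=
    (List.perm_append_singleton a (b :: t)).symm.trans (List.Perm.of_eq hs)
  have hmem := fun v => hperm.mem_iff (a := v)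
  have hn := hperm.nodup_iff.1 h.1
  have hc : (l₁ ++ e :: f :: l₂).IsChain G.Adj := hs ▸ h.2.tail
  rw [hmem] at hw hw'
  constructor
  · have hp : (l₁ ++ e :: w' :: f :: l₂).Perm (w' :: (l₁ ++ e :: f :: l₂)) := by
      simpa using List.perm_middle (l₁ := l₁ ++ [e]) (a := w') (l₂ := f :: l₂)
    rw [List.nodup_cons, hp.nodup_iff, hp.mem_iff]
    simp_all
  · have h1 : (w :: (l₁ ++ e :: f :: l₂) ++ [w]).IsChain G.Adj := by
      have h2 := List.isChain_append_cons_cons (R := G.Adj) (b := a) (c := w) (l₁ := b :: t)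
        (l₂ := [])
      rw [← hs]
      simp only [List.append_assoc, List.cons_append, List.nil_append] at h2 ⊢
      rw [List.isChain_cons_cons, h2]
      exact ⟨hwb, by simpa using h.2.tail, haw, by simp⟩
    have h3 := List.isChain_append_cons_cons (R := G.Adj) (b := e) (c := f) (l₁ := w :: l₁)
      (l₂ := l₂ ++ [w])
    have h4 := List.isChain_append_cons_cons (R := G.Adj) (b := e) (c := w') (l₁ := w :: l₁)
      (l₂ := f :: l₂ ++ [w])
    simp only [List.append_assoc, List.cons_append] at h1 h3 h4 ⊢
    rw [h4]
    rw [h3] at h1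
    simp_all

theorem two_mul_countP_le {p : V → Prop} [DecidablePred p] : ∀ l : List V,
    l.IsChain (fun x y => ¬(p x ∧ p y)) → 2 * l.countP (fun x => decide (p x)) ≤ l.length + 1
  | [] => by simp
  | [x] => by
    simp only [List.countP_cons, List.countP_nil, List.length_cons]
    split <;> simp
  | x :: y :: l => fun h => by
    have h1 := two_mul_countP_le (y :: l) h.tail
    have h2 := two_mul_countP_le l h.tail.tail
    have h3 := h.rel
    simp only [List.countP_cons, List.length_cons, decide_eq_true_eq] at *
    split_ifs at * <;> first | omega | simp_all

theorem two_mul_countP_le_of_cycle {p : V → Prop} [DecidablePred p] {l : List V}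
    (h : (l : Cycle V).Chain (fun x y => ¬(p x ∧ p y))) :
    2 * l.countP (fun x => decide (p x)) ≤ l.length := by
  obtain _ | ⟨a, t⟩ := l
  · simp
  rw [Cycle.chain_coe_cons] at h
  by_cases ha : p a
  · have := two_mul_countP_le _ h
    simp [ha, List.countP_append] at this ⊢
    omega
  · have := two_mul_countP_le t h.tail.left_of_append
    simp [ha] at this ⊢
    omega

theorem exists_isRotated_of_not_chain {p : V → Prop} {l : List V} (hl : 2 ≤ l.length)
    (h : ¬(l : Cycle V).Chain (fun x y => ¬(p x ∧ p y))) :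
    ∃ a b t, l ~r (a :: b :: t) ∧ p a ∧ p b := by
  obtain _ | ⟨a, t⟩ := l
  · simp at hl
  rw [Cycle.chain_coe_cons, List.isChain_iff_forall_rel_of_append_cons_cons] at h
  push Not at h
  obtain ⟨x, y, l₁, l₂, hs, hx, hy⟩ := h
  rcases List.eq_nil_or_concat' l₂ with rfl | ⟨l₂, z, rfl⟩
  · have h1 : a :: t = l₁ ++ [x] ∧ a = y := by
      have : (a :: t) ++ [a] = (l₁ ++ [x]) ++ [y] := by simpa using hs
      simpa using List.append_inj' this rfl
    obtain ⟨h1, rfl⟩ := h1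
    obtain _ | ⟨u, l₁⟩ := l₁
    · simp_all
    · obtain ⟨rfl, rfl⟩ : a = u ∧ t = l₁ ++ [x] := by simpa using h1
      exact ⟨x, a, l₁, List.isRotated_append (l := a :: l₁) (l' := [x]), hx, hy⟩
  · have h1 : a :: t = l₁ ++ x :: y :: l₂ := by
      have : (a :: t) ++ [a] = (l₁ ++ x :: y :: l₂) ++ [z] := by simpa using hs
      exact (List.append_inj' this rfl).1
    exact ⟨x, y, l₂ ++ l₁, h1 ▸ List.isRotated_append, hx, hy⟩

theorem IsCycleList.isChain_of_no_longer {a b w w' : V} {t : List V} {m : ℕ}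
    (h : G.IsCycleList (a :: b :: t)) (hm : (a :: b :: t).length = m)
    (hno : ∀ l, G.IsCycleList l → l.length ≠ m + 2) (hw : w ∉ a :: b :: t)
    (hw' : w' ∉ a :: b :: t) (hne : w ≠ w') (hwa : G.Adj w a) (hwb : G.Adj w b) :
    (b :: t ++ [a]).IsChain (fun x y => ¬(G.Adj w' x ∧ G.Adj w' y)) := by
  rw [List.isChain_iff_forall_rel_of_append_cons_cons]
  rintro e f l₁ l₂ hs ⟨he, hf⟩
  refine hno _ (h.insert_insert hw hw' hne hwa.symm hwb hs he.symm hf) ?_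
  have := congrArg List.length hs
  simp at this hm ⊢
  omega

variable [DecidableRel G.Adj]

/-- The neighbours of `v` inside `R`. -/
def nbrIn (G : SimpleGraph V) [DecidableRel G.Adj] (R : Finset V) (v : V) : Finset V :=
  R.filter (G.Adj v)

@[simp]
theorem mem_nbrIn {R : Finset V} {v x : V} : x ∈ G.nbrIn R v ↔ x ∈ R ∧ G.Adj v x := by
  simp [nbrIn]

variable {R : Finset V} {m D : ℕ}

theorem countP_add_card_nbrIn [Fintype V] {l : List V} (hR : ∀ x, x ∈ R ↔ x ∉ l) (hn : l.Nodup)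
    (v : V) : l.countP (fun x => decide (G.Adj v x)) + (G.nbrIn R v).card = G.degree v := by
  classical
  have h1 : l.countP (fun x => decide (G.Adj v x)) =
      ((G.neighborFinset v).filter (· ∈ l)).card := by
    rw [List.countP_eq_length_filter, ← List.toFinset_card_of_nodup (hn.filter _)]
    congr 1
    ext x
    simp [and_comm]
  have h2 : G.nbrIn R v = (G.neighborFinset v).filter (¬ · ∈ l) := by
    ext x
    simp [hR, and_comm]
  rw [h1, h2, Finset.card_filter_add_card_filter_not, card_neighborFinset_eq_degree]

theorem IsCycleList.not_adj {a b x y : V} {t : List V} (h : G.IsCycleList (a :: b :: t))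
    (hm : (a :: b :: t).length = m) (hno : ∀ l, G.IsCycleList l → l.length ≠ m + 2)
    (hR : ∀ x, x ∈ R ↔ x ∉ a :: b :: t) (hx : x ∈ G.nbrIn R a) (hy : y ∈ G.nbrIn R b) :
    ¬ G.Adj x y := by
  intro hxy
  rw [mem_nbrIn, hR] at hx hy
  refine hno _ (h.insert_two hx.1 hy.1 hx.2 hxy hy.2.symm) ?_
  simpa using hm

theorem IsCycleList.disjoint_nbrIn {a b c x y : V} {t : List V}
    (h : G.IsCycleList (a :: b :: c :: t)) (hm : (a :: b :: c :: t).length = m)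
    (hno : ∀ l, G.IsCycleList l → l.length ≠ m + 2) (hR : ∀ x, x ∈ R ↔ x ∉ a :: b :: c :: t)
    (hx : x ∈ G.nbrIn R a) (hy : y ∈ G.nbrIn R c) (hxy : x ≠ y) :
    Disjoint (G.nbrIn R x) (G.nbrIn R y) := by
  rw [Finset.disjoint_left]
  intro z hz hz'
  rw [mem_nbrIn, hR] at hx hy hz hz'
  refine hno _ (h.replace_two hx.1 hy.1 hz.1 hxy hx.2 hz.2 hz'.2.symm hy.2.symm) ?_
  simpa using hm

theorem IsCycleList.false_of_three {a b c x y z : V} (h : G.IsCycleList [a, b, c])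
    (hno : ∀ l, G.IsCycleList l → l.length ≠ 3 + 2) (hR : ∀ x, x ∈ R ↔ x ∉ [a, b, c])
    (hx : x ∈ G.nbrIn R a) (hy : y ∈ G.nbrIn R b) (hz : z ∈ G.nbrIn R c) (hxy : x ≠ y)
    (hxz : x ≠ z) (hyz : y ≠ z)
    (hcard : R.card < (G.nbrIn R x).card + (G.nbrIn R y).card + (G.nbrIn R z).card) : False := by
  classical
  have h1 := h.disjoint_nbrIn rfl hno hR hx hz hxz
  have r2 : [a, b, c] ~r [b, c, a] := ⟨1, rfl⟩
  have r3 : [a, b, c] ~r [c, a, b] := ⟨2, rfl⟩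
  have h2 := (h.isRotated r2).disjoint_nbrIn rfl hno (fun x => by rw [hR, r2.mem_iff]) hy hx hxy.symm
  have h3 := (h.isRotated r3).disjoint_nbrIn rfl hno (fun x => by rw [hR, r3.mem_iff]) hz hy hyz.symm
  have h4 : (G.nbrIn R x ∪ G.nbrIn R y ∪ G.nbrIn R z).card ≤ R.card :=
    Finset.card_le_card (by intro v; simp only [Finset.mem_union, mem_nbrIn]; tauto)
  rw [Finset.card_union_of_disjoint, Finset.card_union_of_disjoint h2.symm] at h4
  · omega
  · rw [Finset.disjoint_union_left]
    exact ⟨h1, h3.symm⟩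

theorem IsCycleList.false_of_common_neighbors [DecidableEq V] {a b c d e x y : V} {t : List V}
    {E : Finset V}
    (h : G.IsCycleList (a :: b :: c :: d :: e :: t)) (hm : (a :: b :: c :: d :: e :: t).length = m)
    (hno : ∀ l, G.IsCycleList l → l.length ≠ m + 2)
    (hR : ∀ x, x ∈ R ↔ x ∉ a :: b :: c :: d :: e :: t)
    (hx : x ∈ G.nbrIn R a) (hy : y ∈ G.nbrIn R e) (hxy : x ≠ y)
    (hE : ∀ v ∈ R, v ∉ E → D ≤ (G.nbrIn R v).card)
    (h2 : 2 ≤ ((G.nbrIn R x ∩ G.nbrIn R y) \ E).card) (h4 : 4 ≤ (G.nbrIn R x \ E).card)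
    (hc : 3 ≤ (G.nbrIn R c).card) (hRD : R.card + 2 ≤ 3 * D) : False := by
  have key : ∀ u v z, u ∈ G.nbrIn R x → v ∈ G.nbrIn R y → u ≠ v → u ≠ y → v ≠ x →
      z ∈ G.nbrIn R u → z ∈ G.nbrIn R v → z = x ∨ z = y := by
    intro u v z hu hv huv huy hvx hzu hzv
    by_contra! hz
    rw [mem_nbrIn, hR] at hx hy hu hv hzu hzv
    have := hu.2.ne
    have := hv.2.ne
    have := hzu.2.ne
    have := hzv.2.ne
    refine hno _ (h.replace_four hx.1 hy.1 hzu.1 hu.1 hv.1 ?_ hx.2 hu.2 hzu.2 hzv.2.symm hv.2.symm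
      hy.2.symm) ?_
    · simp_all [eq_comm]
    · simpa using hm
  obtain ⟨p, hp, p', hp', hpp⟩ := Finset.one_lt_card.1 h2
  obtain ⟨q, hq⟩ : ((G.nbrIn R x \ E) \ {p, p', y}).Nonempty := by
    rw [← Finset.card_pos]
    have := Finset.le_card_sdiff {p, p', y} (G.nbrIn R x \ E)
    have := Finset.card_le_three (a := p) (b := p') (c := y)
    omega
  simp only [Finset.mem_sdiff, Finset.mem_inter, Finset.mem_insert, Finset.mem_singleton,
    not_or] at hp hp' hq
  have hpx : p ≠ x := fun h => by simp [h] at hp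
  have hpy : p ≠ y := fun h => by simp [h] at hp
  have hpx' : p' ≠ x := fun h => by simp [h] at hp'
  have hpy' : p' ≠ y := fun h => by simp [h] at hp'
  have d1 : Disjoint (G.nbrIn R p \ {x, y}) (G.nbrIn R p' \ {x, y}) := by
    rw [Finset.disjoint_left]
    intro z hz hz'
    simp only [Finset.mem_sdiff, Finset.mem_insert, Finset.mem_singleton] at hz hz'
    exact hz.2 (key p p' z hp.1.1 hp'.1.2 hpp hpy hpx' hz.1 hz'.1)
  have d2 : Disjoint (G.nbrIn R q \ {x, y}) (G.nbrIn R p \ {x, y}) := by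
    rw [Finset.disjoint_left]
    intro z hz hz'
    simp only [Finset.mem_sdiff, Finset.mem_insert, Finset.mem_singleton] at hz hz'
    exact hz.2 (key q p z hq.1.1 hp.1.2 hq.2.1 hq.2.2.2 hpx hz.1 hz'.1)
  have d3 : Disjoint (G.nbrIn R q \ {x, y}) (G.nbrIn R p' \ {x, y}) := by
    rw [Finset.disjoint_left]
    intro z hz hz'
    simp only [Finset.mem_sdiff, Finset.mem_insert, Finset.mem_singleton] at hz hz'
    exact hz.2 (key q p' z hq.1.1 hp'.1.2 hq.2.2.1 hq.2.2.2 hpx' hz.1 hz'.1)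
  have r2 : (a :: b :: c :: d :: e :: t) ~r (c :: d :: e :: (t ++ [a, b])) := ⟨2, by simp⟩
  have hdisj : ∀ z ∈ G.nbrIn R c, x ≠ z → Disjoint (G.nbrIn R x) (G.nbrIn R z) := fun z hz hne =>
    h.disjoint_nbrIn hm hno hR hx hz hne
  have hxc : x ∉ G.nbrIn R c := fun hxc => Finset.disjoint_left.1
    ((h.isRotated r2).disjoint_nbrIn (by rw [← r2.perm.length_eq, hm]) hno
      (fun x => by rw [hR, r2.mem_iff]) hxc hy hxy) hp.1.1 hp.1.2
  have hyc : y ∉ G.nbrIn R c := fun hyc => Finset.disjoint_left.1 (hdisj y hyc hxy) hp.1.1 hp.1.2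
  have hz : ∀ u ∈ G.nbrIn R x, Disjoint (G.nbrIn R u \ {x, y}) (G.nbrIn R c ∪ {x, y}) := by
    intro u hu
    rw [Finset.disjoint_left]
    intro z hz hz'
    simp only [Finset.mem_sdiff, Finset.mem_union] at hz hz'
    have hzc := hz'.resolve_right hz.2
    have hne : x ≠ z := fun h => hxc (h ▸ hzc)
    refine Finset.disjoint_left.1 (hdisj z hzc hne) hu ?_
    rw [mem_nbrIn] at hu hz ⊢
    exact ⟨hu.1, hz.1.2.symm⟩
  have hcard : ((G.nbrIn R p \ {x, y}) ∪ (G.nbrIn R p' \ {x, y}) ∪ (G.nbrIn R q \ {x, y}) ∪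
      (G.nbrIn R c ∪ {x, y})).card ≤ R.card := by
    apply Finset.card_le_card
    intro v
    rw [mem_nbrIn] at hx hy
    simp only [Finset.mem_union, Finset.mem_sdiff, mem_nbrIn, Finset.mem_insert,
      Finset.mem_singleton]
    rintro (((h | h) | h) | (h | rfl | rfl))
    exacts [h.1.1, h.1.1, h.1.1, h.1, hx.1, hy.1]
  rw [Finset.card_union_of_disjoint, Finset.card_union_of_disjoint, Finset.card_union_of_disjoint d1,
    Finset.card_union_of_disjoint (t := {x, y}), Finset.card_pair hxy] at hcard
  · have e1 := Finset.le_card_sdiff {x, y} (G.nbrIn R p)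
    have e2 := Finset.le_card_sdiff {x, y} (G.nbrIn R p')
    have e3 := Finset.le_card_sdiff {x, y} (G.nbrIn R q)
    rw [Finset.card_pair hxy] at e1 e2 e3
    have f1 := hE p (mem_nbrIn.1 hp.1.1).1 hp.2
    have f2 := hE p' (mem_nbrIn.1 hp'.1.1).1 hp'.2
    have f3 := hE q (mem_nbrIn.1 hq.1.1).1 hq.1.2
    omega
  · simp only [Finset.disjoint_insert_right, Finset.disjoint_singleton_right]
    exact ⟨hxc, hyc⟩
  · rw [Finset.disjoint_union_left]
    exact ⟨d2.symm, d3.symm⟩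
  · rw [Finset.disjoint_union_left, Finset.disjoint_union_left]
    exact ⟨⟨hz p hp.1.1, hz p' hp'.1.1⟩, hz q hq.1.1⟩

theorem exists_distinct_of_ne [DecidableEq V] {A B C : Finset V} (hA : 2 ≤ A.card) (hB : 2 ≤ B.card)
    (hC : 2 ≤ C.card) (hne : A ≠ B) :
    ∃ a ∈ A, ∃ b ∈ B, ∃ c ∈ C, a ≠ b ∧ a ≠ c ∧ b ≠ c := by
  by_cases h : A ⊆ B
  · obtain ⟨b, hb, hbA⟩ := Finset.exists_of_ssubset (h.ssubset_of_ne hne)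
    obtain ⟨c, hc, hcb⟩ := Finset.exists_mem_ne hC b
    obtain ⟨a, ha, hac⟩ := Finset.exists_mem_ne hA c
    exact ⟨a, ha, b, hb, c, hc, fun h => hbA (h ▸ ha), hac, hcb.symm⟩
  · obtain ⟨a, ha, haB⟩ := Finset.not_subset.1 h
    obtain ⟨c, hc, hca⟩ := Finset.exists_mem_ne hC a
    obtain ⟨b, hb, hbc⟩ := Finset.exists_mem_ne hB c
    exact ⟨a, ha, b, hb, c, hc, fun h => haB (h ▸ hb), hca.symm, hbc⟩

theorem card_add_card_add_card_le_s12 [DecidableEq V] {S T U R Z : Finset V} (hSU : Disjoint S U)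
    (hTU : Disjoint T U) (hS : S ⊆ R \ Z) (hT : T ⊆ R \ Z) (hU : U ⊆ R \ Z) :
    S.card + T.card + U.card ≤ (R \ Z).card + (S ∩ T).card := by
  have h1 := Finset.card_union_add_card_inter S T
  have h2 : (S ∪ T ∪ U).card ≤ (R \ Z).card :=
    Finset.card_le_card (Finset.union_subset (Finset.union_subset hS hT) hU)
  rw [Finset.card_union_of_disjoint (Finset.disjoint_union_left.2 ⟨hSU, hTU⟩)] at h2
  omega

theorem nbrIn_subset (v : V) : G.nbrIn R v ⊆ R := Finset.filter_subset _ _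

/-- The case in which at most one vertex outside the cycle is adjacent to two consecutive
vertices of the cycle. -/
theorem IsCycleList.false_of_card_le_one [DecidableEq V] {l : List V} {W : Finset V}
    (h : G.IsCycleList l) (hm : l.length = m) (hodd : Odd m) (hm3 : 3 ≤ m)
    (hno : ∀ l, G.IsCycleList l → l.length ≠ m + 2) (hR : ∀ x, x ∈ R ↔ x ∉ l)
    (hW : W.card ≤ 1)
    (hchain : ∀ y ∈ R, y ∉ W → (l : Cycle V).Chain (fun u v => ¬(G.Adj y u ∧ G.Adj y v)))
    (hout : ∀ v ∈ l, 3 ≤ (G.nbrIn R v).card)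
    (hD : ∀ y ∈ R, y ∉ W → D ≤ (G.nbrIn R y).card) (hRD : R.card + 3 ≤ 3 * D)
    (hD5 : 5 ≤ m → 5 ≤ D) : False := by
  have hout' : ∀ v ∈ l, 2 ≤ (G.nbrIn R v \ W).card := fun v hv => by
    have := hout v hv
    have := Finset.le_card_sdiff W (G.nbrIn R v)
    omega
  have hdisj : ∀ a b t, l ~r (a :: b :: t) → Disjoint (G.nbrIn R a \ W) (G.nbrIn R b \ W) := by
    intro a b t hr
    rw [Finset.disjoint_left]
    intro y hya hyb
    simp only [Finset.mem_sdiff, mem_nbrIn] at hya hyb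
    have := hchain y hya.1.1 hya.2
    rw [Cycle.coe_eq_coe.2 hr, Cycle.chain_coe_cons] at this
    exact this.rel ⟨hya.1.2.symm, hyb.1.2.symm⟩
  obtain rfl | hm5 : m = 3 ∨ 5 ≤ m := by obtain ⟨j, rfl⟩ := hodd; omega
  · obtain ⟨a, b, c, rfl⟩ := List.length_eq_three.1 hm
    obtain ⟨x, hx⟩ := Finset.card_pos.1 (lt_of_lt_of_le two_pos (hout' a (by simp)))
    obtain ⟨y, hy⟩ := Finset.card_pos.1 (lt_of_lt_of_le two_pos (hout' b (by simp)))
    obtain ⟨z, hz⟩ := Finset.card_pos.1 (lt_of_lt_of_le two_pos (hout' c (by simp)))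
    have h1 := fun h : x = y => Finset.disjoint_left.1 (hdisj a b [c] ⟨0, rfl⟩) hx (h ▸ hy)
    have h2 := fun h : y = z => Finset.disjoint_left.1 (hdisj b c [a] ⟨1, rfl⟩) hy (h ▸ hz)
    have h3 := fun h : z = x => Finset.disjoint_left.1 (hdisj c a [b] ⟨2, rfl⟩) hz (h ▸ hx)
    rw [Finset.mem_sdiff] at hx hy hz
    have := hD x (nbrIn_subset _ hx.1) hx.2
    have := hD y (nbrIn_subset _ hy.1) hy.2
    have := hD z (nbrIn_subset _ hz.1) hz.2
    exact h.false_of_three hno hR hx.1 hy.1 hz.1 h1 (Ne.symm h3) h2 (by omega)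
  have key : ∀ a b c d e t, l ~r (a :: b :: c :: d :: e :: t) →
      G.nbrIn R a \ W = G.nbrIn R c \ W := by
    intro a b c d e t hr
    by_contra hne
    have hmem := fun v => hr.mem_iff (a := v)
    obtain ⟨x, hx, z, hz, y, hy, hxz, hxy, hzy⟩ := exists_distinct_of_ne
      (hout' a (by simp [hmem])) (hout' c (by simp [hmem])) (hout' e (by simp [hmem])) hne
    rw [Finset.mem_sdiff] at hx hy hz
    have h' := h.isRotated hr
    have hm' := hr.perm.length_eq.symm.trans hm
    have hR' : ∀ x, x ∈ R ↔ x ∉ a :: b :: c :: d :: e :: t := fun x => by rw [hR, hmem]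
    have hdx := hD x (nbrIn_subset _ hx.1) hx.2
    have hdy := hD y (nbrIn_subset _ hy.1) hy.2
    have hdz := hD z (nbrIn_subset _ hz.1) hz.2
    have hxz' := h'.disjoint_nbrIn hm' hno hR' hx.1 hz.1 hxz
    have r2 : (a :: b :: c :: d :: e :: t) ~r (c :: d :: e :: (t ++ [a, b])) := ⟨2, by simp⟩
    have hzy' := (h'.isRotated r2).disjoint_nbrIn (by rw [← r2.perm.length_eq, hm']) hno
      (fun x => by rw [hR', r2.mem_iff]) hz.1 hy.1 hzy
    have hsub : ∀ v, G.nbrIn R v ⊆ R \ ∅ := fun v => by simpa using nbrIn_subset v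
    have hcard := card_add_card_add_card_le_s12 hxz' hzy'.symm (hsub x) (hsub y) (hsub z)
    rw [Finset.sdiff_empty] at hcard
    refine h'.false_of_common_neighbors hm' hno hR' hx.1 hy.1 hxy hD ?_ ?_
      (hout c (by simp [hmem])) (by omega)
    · have := Finset.le_card_sdiff W (G.nbrIn R x ∩ G.nbrIn R y)
      omega
    · have := Finset.le_card_sdiff W (G.nbrIn R x)
      have := hD5 hm5
      omega
  obtain ⟨a₀, ha₀⟩ := List.exists_mem_of_length_pos (l := l) (by omega)
  have hpat : ∀ s, ∃ a b c d e t, l.rotate s = a :: b :: c :: d :: e :: t := by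
    intro s
    have hlen : (l.rotate s).length = m := by simpa using hm
    generalize l.rotate s = l' at hlen
    rcases l' with _ | ⟨a, _ | ⟨b, _ | ⟨c, _ | ⟨d, _ | ⟨e, t⟩⟩⟩⟩⟩
    · simp at hlen; omega
    · simp at hlen; omega
    · simp at hlen; omega
    · simp at hlen; omega
    · simp at hlen; omega
    · exact ⟨a, b, c, d, e, t, rfl⟩
  set f : ℕ → Finset V := fun s => G.nbrIn R ((l.rotate s).headD a₀) \ W with hf
  have hf2 : ∀ s, f (s + 2) = f s := by
    intro s
    obtain ⟨a, b, c, d, e, t, hs⟩ := hpat s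
    have := key a b c d e t ⟨s, hs⟩
    simp [hf, ← List.rotate_rotate, hs, this]
  have hf2' : ∀ i, f (2 * i) = f 0 := by
    intro i
    induction i with
    | zero => rfl
    | succ i ih => rw [mul_add, mul_one, hf2, ih]
  have hf01 : f 1 = f 0 := by
    obtain ⟨j, rfl⟩ := hodd
    rw [← hf2' (j + 1), show 2 * (j + 1) = (2 * j + 1) + 1 by ring]
    simp only [hf]
    rw [← List.rotate_rotate, ← hm, List.rotate_length]
  obtain ⟨a, b, c, d, e, t, hs⟩ := hpat 0
  rw [List.rotate_zero] at hs
  subst hs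
  have h1 := hdisj a b _ (List.IsRotated.refl _)
  have h2 : G.nbrIn R b \ W = G.nbrIn R a \ W := by simpa [hf] using hf01
  rw [h2, disjoint_self, Finset.bot_eq_empty, ← Finset.card_eq_zero] at h1
  have := hout' a (by simp)
  omega

/-- The case in which at least two vertices outside the cycle are adjacent to the ends of the first
edge of the cycle, and no vertex outside the cycle is adjacent to the ends of another edge. -/
theorem IsCycleList.false_of_two_le_card [DecidableEq V] {a b : V} {t : List V}
    (h : G.IsCycleList (a :: b :: t)) (hm : (a :: b :: t).length = m) (hodd : Odd m) (hm3 : 3 ≤ m)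
    (hno : ∀ l, G.IsCycleList l → l.length ≠ m + 2) (hR : ∀ x, x ∈ R ↔ x ∉ a :: b :: t)
    (hI : 2 ≤ (G.nbrIn R a ∩ G.nbrIn R b).card)
    (hchain : ∀ y ∈ R, (b :: t ++ [a]).IsChain (fun u v => ¬(G.Adj y u ∧ G.Adj y v)))
    (hout : ∀ v ∈ a :: b :: t, 3 ≤ (G.nbrIn R v).card)
    (hD : ∀ y ∈ R, y ∉ G.nbrIn R a ∩ G.nbrIn R b → D ≤ (G.nbrIn R y).card)
    (hD' : ∀ y ∈ R, D ≤ (G.nbrIn R y).card + 1) (hRD : R.card + 3 ≤ 3 * D)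
    (hD5 : 5 ≤ m → 5 ≤ D) : False := by
  obtain ⟨x, hx, x', hx', hxx'⟩ := Finset.one_lt_card.1 hI
  rw [Finset.mem_inter] at hx hx'
  obtain rfl | hm5 : m = 3 ∨ 5 ≤ m := by obtain ⟨j, rfl⟩ := hodd; omega
  · obtain ⟨c, rfl⟩ := List.length_eq_one_iff.1 (show t.length = 1 by simpa using hm)
    obtain ⟨z, hz⟩ := Finset.card_pos.1 (lt_of_lt_of_le three_pos (hout c (by simp)))
    have hzR := nbrIn_subset _ hz
    have hzb : z ∉ G.nbrIn R b := fun hzb =>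
      (hchain z hzR).rel ⟨(mem_nbrIn.1 hzb).2.symm, (mem_nbrIn.1 hz).2.symm⟩
    have h1 := hD z hzR (by simp [hzb])
    have h2 := hD' x (nbrIn_subset _ hx.1)
    have h3 := hD' x' (nbrIn_subset _ hx'.1)
    exact h.false_of_three hno hR hx.1 hx'.2 hz hxx' (fun h => hzb (h ▸ hx.2))
      (fun h => hzb (h ▸ hx'.2)) (by omega)
  obtain _ | ⟨c, _ | ⟨d, _ | ⟨e, t⟩⟩⟩ := t
  · simp at hm; omega
  · simp at hm; omega
  · simp at hm; omega
  have hbc : ∀ z ∈ G.nbrIn R c, z ∉ G.nbrIn R b := fun z hz hzb =>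
    (hchain z (nbrIn_subset _ hz)).rel ⟨(mem_nbrIn.1 hzb).2.symm, (mem_nbrIn.1 hz).2.symm⟩
  have r1 : (a :: b :: c :: d :: e :: t) ~r (b :: c :: d :: e :: (t ++ [a])) := ⟨1, by simp⟩
  have r2 : (a :: b :: c :: d :: e :: t) ~r (c :: d :: e :: (t ++ [a, b])) := ⟨2, by simp⟩
  obtain ⟨y, hy, hyx⟩ := Finset.exists_mem_ne (lt_of_lt_of_le (by norm_num) (hout e (by simp))) x
  obtain ⟨z, hz, hzy⟩ := Finset.exists_mem_ne (lt_of_lt_of_le (by norm_num) (hout c (by simp))) y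
  have hxz : x ≠ z := fun h => hbc z hz (h ▸ hx.2)
  have hxz' := h.disjoint_nbrIn hm hno hR hx.1 hz hxz
  have hzy' := (h.isRotated r2).disjoint_nbrIn (by rw [← r2.perm.length_eq, hm]) hno
    (fun x => by rw [hR, r2.mem_iff]) hz hy hzy
  have ha : ∀ v ∈ G.nbrIn R a, ∀ u ∈ G.nbrIn R v, u ∉ G.nbrIn R b := fun v hv u hu hub =>
    h.not_adj hm hno hR hv hub (mem_nbrIn.1 hu).2
  have hc : ∀ v ∈ G.nbrIn R c, ∀ u ∈ G.nbrIn R v, u ∉ G.nbrIn R b := fun v hv u hu hub =>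
    (h.isRotated r1).not_adj (by rw [← r1.perm.length_eq, hm]) hno
      (fun x => by rw [hR, r1.mem_iff]) hub hv (mem_nbrIn.1 hu).2.symm
  have hxI : ∀ S : Finset V, S ⊆ G.nbrIn R x → S \ (G.nbrIn R a ∩ G.nbrIn R b) = S := by
    intro S hS
    rw [Finset.sdiff_eq_self_iff_disjoint, Finset.disjoint_left]
    exact fun u hu hu' => ha x hx.1 u (hS hu) (Finset.mem_inter.1 hu').2
  have hdx := hD' x (nbrIn_subset _ hx.1)
  have hdy' := hD' y (nbrIn_subset _ hy)
  have hdz := hD z (nbrIn_subset _ hz) (fun h => hbc z hz (Finset.mem_inter.1 h).2)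
  refine h.false_of_common_neighbors hm hno hR hx.1 hy hyx.symm hD ?_ ?_
    (hout c (by simp)) (by omega)
  · rw [hxI _ Finset.inter_subset_left]
    by_cases hyI : y ∈ G.nbrIn R a ∩ G.nbrIn R b
    · have hsub : ∀ v, (∀ u ∈ G.nbrIn R v, u ∉ G.nbrIn R b) → G.nbrIn R v ⊆ R \ G.nbrIn R b :=
        fun v hv u hu => Finset.mem_sdiff.2 ⟨nbrIn_subset _ hu, hv u hu⟩
      have hcard := card_add_card_add_card_le_s12 hxz' hzy'.symm (hsub x (ha x hx.1))
        (hsub y (ha y (Finset.mem_inter.1 hyI).1)) (hsub z (hc z hz))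
      rw [Finset.card_sdiff_of_subset (nbrIn_subset _)] at hcard
      have := hout b (by simp)
      omega
    · have hdy := hD y (nbrIn_subset _ hy) hyI
      have hsub : ∀ v, G.nbrIn R v ⊆ R \ ∅ := fun v => by simpa using nbrIn_subset v
      have hcard := card_add_card_add_card_le_s12 hxz' hzy'.symm (hsub x) (hsub y) (hsub z)
      rw [Finset.sdiff_empty] at hcard
      omega
  · rw [hxI _ subset_rfl]
    have := hD5 hm5
    omega

/-- If all degrees are at least `δ`, where `2 * j + 3 ≤ δ` and `δ` exceeds two fifths of the number
of vertices, then a cycle of length `2 * j + 1` yields one of length `2 * j + 3`. -/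
theorem IsCycleList.exists_longer [Fintype V] {l : List V} {j δ : ℕ} (h : G.IsCycleList l)
    (hl : l.length = 2 * j + 1) (hj : 1 ≤ j) (hδ : ∀ v, δ ≤ G.degree v) (hjδ : 2 * j + 3 ≤ δ)
    (hV : 2 * Fintype.card V + 1 ≤ 5 * δ) :
    ∃ l', G.IsCycleList l' ∧ l'.length = 2 * j + 3 := by
  classical
  by_contra! hno
  obtain ⟨R, hR⟩ : ∃ R : Finset V, ∀ x, x ∈ R ↔ x ∉ l :=
    ⟨Finset.univ.filter (· ∉ l), fun x => by simp⟩
  have hRc : R.card + (2 * j + 1) = Fintype.card V := by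
    have h1 : R = (l.toFinset)ᶜ := by
      ext x
      simp [hR]
    rw [h1, ← hl, ← List.toFinset_card_of_nodup h.1, Finset.card_compl_add_card]
  have hcount : ∀ v, l.countP (fun x => decide (G.Adj v x)) + (G.nbrIn R v).card = G.degree v :=
    countP_add_card_nbrIn hR h.1
  have hout : ∀ v ∈ l, 3 ≤ (G.nbrIn R v).card := by
    intro v hv
    have h1 : l.countP (fun x => decide (G.Adj v x)) < l.length := by
      rw [List.countP_lt_length_iff]
      exact ⟨v, hv, by simp⟩
    have := hcount v
    have := hδ v
    omega
  have hD : ∀ y, (l : Cycle V).Chain (fun u v => ¬(G.Adj y u ∧ G.Adj y v)) →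
      δ - j ≤ (G.nbrIn R y).card := by
    intro y hy
    have := two_mul_countP_le_of_cycle hy
    have := hcount y
    have := hδ y
    omega
  have hodd : Odd (2 * j + 1) := ⟨j, rfl⟩
  by_cases hW : ∃ W : Finset V, W.card ≤ 1 ∧
      ∀ y ∈ R, y ∉ W → (l : Cycle V).Chain (fun u v => ¬(G.Adj y u ∧ G.Adj y v))
  · obtain ⟨W, hW1, hW⟩ := hW
    exact h.false_of_card_le_one hl hodd (by omega) hno hR hW1 hW hout
      (fun y hy hyW => hD y (hW y hy hyW)) (by omega) (by omega)
  have hW : ∀ W : Finset V, W.card ≤ 1 → ∃ y ∈ R, y ∉ W ∧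
      ¬(l : Cycle V).Chain (fun u v => ¬(G.Adj y u ∧ G.Adj y v)) := fun W hW1 => by
    by_contra hn
    exact hW ⟨W, hW1, fun y hy hyW => by_contra fun hc => hn ⟨y, hy, hyW, hc⟩⟩
  obtain ⟨w, hwR, -, hw⟩ := hW ∅ (by simp)
  obtain ⟨w', hwR', hww', hw'⟩ := hW {w} (by simp)
  rw [Finset.mem_singleton] at hww'
  obtain ⟨a, b, t, hr, hwa, hwb⟩ := exists_isRotated_of_not_chain (p := G.Adj w) (by omega) hw
  have hmem := fun v => hr.mem_iff (a := v)
  have h' := h.isRotated hr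
  have hl' := hr.perm.length_eq.symm.trans hl
  have hR' : ∀ x, x ∈ R ↔ x ∉ a :: b :: t := fun x => by rw [hR, hmem]
  have hcyc : ∀ y, (b :: t ++ [a]).IsChain (fun u v => ¬(G.Adj y u ∧ G.Adj y v)) →
      ¬(G.Adj y a ∧ G.Adj y b) → (l : Cycle V).Chain (fun u v => ¬(G.Adj y u ∧ G.Adj y v)) := by
    intro y hy hab
    rw [Cycle.coe_eq_coe.2 hr, Cycle.chain_coe_cons, List.cons_append, List.isChain_cons_cons]
    exact ⟨hab, hy⟩
  have hne : ∀ y ∈ R, y ≠ w → (b :: t ++ [a]).IsChain (fun u v => ¬(G.Adj y u ∧ G.Adj y v)) :=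
    fun y hy hyw => h'.isChain_of_no_longer hl' hno ((hR' w).1 hwR) ((hR' y).1 hy) hyw.symm hwa hwb
  have hab' : G.Adj w' a ∧ G.Adj w' b := by
    by_contra hab
    exact hw' (hcyc w' (hne w' hwR' hww') hab)
  have hall : ∀ y ∈ R, (b :: t ++ [a]).IsChain (fun u v => ¬(G.Adj y u ∧ G.Adj y v)) := by
    intro y hy
    by_cases hyw : y = w
    · rw [hyw]
      exact h'.isChain_of_no_longer hl' hno ((hR' w').1 hwR') ((hR' w).1 hwR) hww' hab'.1 hab'.2
    · exact hne y hy hyw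
  refine h'.false_of_two_le_card (D := δ - j) hl' hodd (by omega) hno hR' ?_ hall
    (fun v hv => hout v ((hmem v).2 hv)) ?_ ?_ (by omega) (by omega)
  · refine Finset.one_lt_card.2 ⟨w, ?_, w', ?_, Ne.symm hww'⟩
    · simp [hwR, hwa.symm, hwb.symm]
    · simp [hwR', hab'.1.symm, hab'.2.symm]
  · intro y hy hyI
    refine hD y (hcyc y (hall y hy) fun hab => hyI ?_)
    simp [hy, hab.1.symm, hab.2.symm]
  · intro y hy
    have h1 := two_mul_countP_le _ (hall y hy)
    have hp : l.Perm (b :: t ++ [a]) := hr.perm.trans (List.perm_append_singleton a (b :: t)).symm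
    rw [← hp.countP_eq, ← hp.length_eq] at h1
    have := hcount y
    have := hδ y
    omega

theorem exists_isCycleList_of_not_colorable [Fintype V] {δ : ℕ} (hδ : ∀ v, δ ≤ G.degree v)
    (hV : 2 * Fintype.card V + 1 ≤ 5 * δ) (hG : ¬ G.Colorable 2) :
    ∃ l, G.IsCycleList l ∧ l.length = 3 := by
  classical
  have hV0 : Nonempty V := by
    by_contra hV0
    rw [not_nonempty_iff] at hV0
    exact hG (Colorable.of_isEmpty 2)
  have hmin : δ ≤ G.minDegree := G.le_minDegree_of_forall_le_degree δ hδ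
  have hclique : ¬ G.CliqueFree 3 := fun h =>
    hG (colorable_of_cliqueFree_lt_minDegree (r := 2) h (by omega))
  simp only [CliqueFree, not_forall, not_not, is3Clique_iff] at hclique
  obtain ⟨s, a, b, c, hab, hac, hbc, -⟩ := hclique
  refine ⟨[a, b, c], isCycleList_cons.2 ⟨?_, ?_⟩, rfl⟩
  · simp [hab.ne, hac.ne, hbc.ne]
  · simp [hab, hbc, hac.symm]

/-- A graph which is not bipartite and whose degrees are at least `δ`, where `δ` exceeds two fifths
of the number of vertices, contains cycles of all odd lengths between `3` and `δ`. -/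
theorem exists_isCycleList_of_odd [Fintype V] {δ j : ℕ} (hδ : ∀ v, δ ≤ G.degree v)
    (hV : 2 * Fintype.card V + 1 ≤ 5 * δ) (hG : ¬ G.Colorable 2) (hj : 1 ≤ j)
    (hjδ : 2 * j + 1 ≤ δ) : ∃ l, G.IsCycleList l ∧ l.length = 2 * j + 1 := by
  induction j, hj using Nat.le_induction with
  | base => exact exists_isCycleList_of_not_colorable hδ hV hG
  | succ j hj ih =>
    obtain ⟨l, h, hl⟩ := ih (by omega)
    exact h.exists_longer hl hj hδ (by omega) hV

end SimpleGraph

/-- Let `k ≥ 2` and let `H` be a `C_{2k+1}`-free graph on `N ≥ 5k`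
vertices whose minimum degree exceeds `2N/5`. Then `H` is bipartite. -/
theorem stmt_12 {V : Type*} [Fintype V] (k N : ℕ) (hk : 2 ≤ k)
    (hcard : Fintype.card V = N) (hN : 5 * k ≤ N) (H : SimpleGraph V)
    (hfree : H.CycleFree (2 * k + 1))
    (hdeg : ∀ v : V, 2 * N < 5 * (H.neighborSet v).ncard) :
    ∃ A : Set V, ∀ ⦃x y : V⦄, H.Adj x y → ((x ∈ A ∧ y ∉ A) ∨ (x ∉ A ∧ y ∈ A)) := by
  classical
  have hcol : H.Colorable 2 := by
    by_contra hcol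
    have hδ : ∀ v, 2 * N / 5 + 1 ≤ H.degree v := by
      intro v
      have := hdeg v
      rw [Set.ncard_eq_toFinset_card', Set.toFinset_card, SimpleGraph.card_neighborSet_eq_degree] at this
      omega
    obtain ⟨l, h, hl⟩ := SimpleGraph.exists_isCycleList_of_odd (j := k) hδ (by omega) hcol
      (by omega) (by omega)
    obtain ⟨v, w, hw, hwl⟩ := h.exists_isCycle (by omega)
    exact hfree w hw (hwl.trans hl)
  obtain ⟨C⟩ := hcol
  refine ⟨{v | C v = 0}, fun x y hxy => ?_⟩
  have := C.valid hxy
  simp only [Set.mem_ofPred_eq]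
  omega
end

section
/- Let k ≥ 2, 3 ≤ r ≤ 2k and n ≥ r+1 be integers, and let G be a graph obtained from the bipartite Turán graph T_{n−r+1,2} by suspending K_r (identifying one vertex of a complete graph on r vertices with any vertex of T_{n−r+1,2}). Then G is C_{2k+1}-free, e(G) = ⌊(n−r+1)²/4⌋ + C(r,2), and the chromatic number of G equals r. -/
namespace turanSuspAt

variable {n q v0 : ℕ}

lemma adj_iff {i j : Fin n} :
    (turanSuspAt n q v0).Adj i j ↔ i ≠ j ∧
      (((i : ℕ) < q / 2 ∧ q / 2 ≤ (j : ℕ) ∧ (j : ℕ) < q) ∨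
        ((j : ℕ) < q / 2 ∧ q / 2 ≤ (i : ℕ) ∧ (i : ℕ) < q) ∨
        (((i : ℕ) = v0 ∨ q ≤ (i : ℕ)) ∧ ((j : ℕ) = v0 ∨ q ≤ (j : ℕ)))) := by
  simp only [turanSuspAt, SimpleGraph.fromRel_adj]
  tauto

/-- The vertices of the suspended clique. -/
def cliqueVerts (n q v0 : ℕ) : Finset (Fin n) := {i | (i : ℕ) = v0 ∨ q ≤ (i : ℕ)}

lemma mem_cliqueVerts {i : Fin n} : i ∈ cliqueVerts n q v0 ↔ (i : ℕ) = v0 ∨ q ≤ (i : ℕ) := by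
  simp [cliqueVerts]

lemma card_filter_Ico {a b : ℕ} (hb : b ≤ n) :
    ({i : Fin n | a ≤ (i : ℕ) ∧ (i : ℕ) < b} : Finset (Fin n)).card = b - a := by
  rw [← Finset.card_map Fin.valEmbedding, ← Nat.card_Ico]
  congr 1
  ext x
  simp only [Finset.mem_map, Finset.mem_filter, Finset.mem_univ, true_and,
    Fin.valEmbedding_apply, Finset.mem_Ico]
  constructor
  · rintro ⟨i, hi, rfl⟩
    exact hi
  · exact fun hx => ⟨⟨x, by omega⟩, hx, rfl⟩

lemma card_cliqueVerts (hv0 : v0 < q) (hq : q ≤ n) : (cliqueVerts n q v0).card = n - q + 1 := by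
  have h : cliqueVerts n q v0 =
      insert ⟨v0, by omega⟩ ({i : Fin n | q ≤ (i : ℕ) ∧ (i : ℕ) < n} : Finset (Fin n)) := by
    ext i
    simp [mem_cliqueVerts, Fin.ext_iff]
  rw [h, Finset.card_insert_of_notMem (by simp; omega), card_filter_Ico le_rfl]

lemma isClique_cliqueVerts :
    (turanSuspAt n q v0).IsClique (cliqueVerts n q v0 : Set (Fin n)) := by
  intro i hi j hj hij
  rw [Finset.mem_coe, mem_cliqueVerts] at hi hj
  exact adj_iff.2 ⟨hij, Or.inr (Or.inr ⟨hi, hj⟩)⟩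

/-- A walk leaving the new vertices of the suspended clique passes through the cut vertex. -/
lemma exists_mem_support_val_eq {x y : Fin n} (p : (turanSuspAt n q v0).Walk x y)
    (hx : q ≤ (x : ℕ)) (hy : (y : ℕ) < q) : ∃ c ∈ p.support, (c : ℕ) = v0 := by
  obtain ⟨d, hd, h1, h2⟩ := p.exists_boundary_dart {z | q ≤ (z : ℕ)} hx (by simpa using hy)
  refine ⟨d.snd, p.dart_snd_mem_support_of_mem_darts hd, ?_⟩
  have := (adj_iff.1 d.adj).2
  simp only [Set.mem_ofPred_eq] at h1 h2
  omega

lemma even_length_iff {x y : Fin n} (p : (turanSuspAt n q v0).Walk x y)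
    (hp : ∀ z ∈ p.support, (z : ℕ) < q) :
    Even p.length ↔ ((x : ℕ) < q / 2 ↔ (y : ℕ) < q / 2) := by
  induction p with
  | nil => simp
  | @cons u v w h p ih =>
    have hu := hp u (by simp)
    have hv := hp v (by simp)
    have ih := ih fun z hz => hp z (by simp [hz])
    have hne : (u : ℕ) ≠ v := fun h' => h.ne (Fin.ext h')
    have := (adj_iff.1 h).2
    have huv : (u : ℕ) < q / 2 ↔ ¬ (v : ℕ) < q / 2 := by omega
    rw [SimpleGraph.Walk.length_cons, Nat.even_add_one, ih, huv, not_iff]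

/-- A cycle through a new vertex of the suspended clique stays inside the clique. -/
lemma support_subset_cliqueVerts {x : Fin n} {p : (turanSuspAt n q v0).Walk x x}
    (hp : p.IsCycle) (hv0 : v0 < q) (hx : q ≤ (x : ℕ)) :
    ∀ y ∈ p.support, y ∈ cliqueVerts n q v0 := by
  intro y hy
  rw [mem_cliqueVerts]
  by_contra! hyC
  obtain ⟨c, hc, hcv⟩ := exists_mem_support_val_eq (p.takeUntil y hy) hx hyC.2
  obtain ⟨d, hd, hdv⟩ := exists_mem_support_val_eq (p.dropUntil y hy).reverse hx hyC.2
  obtain rfl : c = d := Fin.ext (hcv.trans hdv.symm)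
  rw [SimpleGraph.Walk.support_reverse, List.mem_reverse] at hd
  have hcx : c ≠ x := by rintro rfl; omega
  have hcy : c ≠ y := by rintro rfl; omega
  have hc' := ((SimpleGraph.Walk.mem_support_iff _).1 hc).resolve_left hcx
  have hd' := ((SimpleGraph.Walk.mem_support_iff _).1 hd).resolve_left hcy
  have hnodup := hp.support_nodup
  rw [← p.take_spec hy, SimpleGraph.Walk.tail_support_append] at hnodup
  exact (List.nodup_append'.1 hnodup).2.2 hc' hd'

lemma cycleFree_of_odd {m : ℕ} (hm : Odd m) (hv0 : v0 < q) (hq : q ≤ n) (hlt : n - q + 1 < m) :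
    (turanSuspAt n q v0).CycleFree m := by
  intro v w hw hlen
  by_cases h : ∀ z ∈ w.support, (z : ℕ) < q
  · have := (even_length_iff w h).2 Iff.rfl
    rw [hlen] at this
    exact Nat.not_even_iff_odd.2 hm this
  · push Not at h
    obtain ⟨x, hx, hxq⟩ := h
    have hcyc := hw.rotate hx
    have hsub : (w.rotate x hx).support.tail.toFinset ⊆ cliqueVerts n q v0 := by
      intro y hy
      exact support_subset_cliqueVerts hcyc hv0 hxq y (List.mem_of_mem_tail (by simpa using hy))
    have hcard := Finset.card_le_card hsub
    rw [List.toFinset_card_of_nodup hcyc.support_nodup, card_cliqueVerts hv0 hq,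
      List.length_tail, SimpleGraph.Walk.length_support, SimpleGraph.Walk.length_rotate] at hcard
    omega

lemma ncard_edgeSet (hv0 : v0 < q) (hq : q ≤ n) :
    (turanSuspAt n q v0).edgeSet.ncard = q ^ 2 / 4 + (n - q + 1).choose 2 := by
  classical
  set A : Finset (Fin n) := {i | 0 ≤ (i : ℕ) ∧ (i : ℕ) < q / 2} with hA
  set B : Finset (Fin n) := {i | q / 2 ≤ (i : ℕ) ∧ (i : ℕ) < q} with hB
  have hE : (turanSuspAt n q v0).edgeSet =
      (((A ×ˢ B).image fun x => s(x.1, x.2)) ∪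
        ((cliqueVerts n q v0).offDiag.image fun x => s(x.1, x.2)) : Finset (Sym2 (Fin n))) := by
    ext e
    induction e with
    | _ i j =>
      simp only [SimpleGraph.mem_edgeSet, adj_iff, Finset.coe_union, Finset.coe_image,
        Set.mem_union, Set.mem_image, Finset.mem_coe, Finset.mem_product, Finset.mem_offDiag,
        Prod.exists, Sym2.eq_iff, mem_cliqueVerts, hA, hB, Finset.mem_filter, Finset.mem_univ,
        true_and, ne_eq, Fin.ext_iff]
      constructor
      · rintro ⟨hne, h | h | h⟩
        · exact Or.inl ⟨i, j, by omega, by simp⟩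
        · exact Or.inl ⟨j, i, by omega, by simp⟩
        · exact Or.inr ⟨i, j, by tauto, by simp⟩
      · rintro (⟨a, b, h, h'⟩ | ⟨a, b, h, h'⟩) <;> omega
  have hdisj : Disjoint ((A ×ˢ B).image fun x => s(x.1, x.2))
      ((cliqueVerts n q v0).offDiag.image fun x => s(x.1, x.2)) := by
    simp only [Finset.disjoint_left, Finset.mem_image, Finset.mem_product, Finset.mem_offDiag,
      Prod.exists, mem_cliqueVerts, hA, hB, Finset.mem_filter, Finset.mem_univ, true_and]
    rintro _ ⟨a, b, hab, rfl⟩ ⟨c, d, hcd, h⟩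
    rw [Sym2.eq_iff] at h
    simp only [ne_eq, Fin.ext_iff] at h hcd
    omega
  have hinj : Set.InjOn (fun x : Fin n × Fin n => s(x.1, x.2)) (A ×ˢ B : Finset _) := by
    rintro ⟨a, b⟩ hab ⟨c, d⟩ hcd h
    simp only [Finset.mem_coe, Finset.mem_product, hA, hB, Finset.mem_filter, Finset.mem_univ,
      true_and] at hab hcd
    simp only [Sym2.eq_iff, Fin.ext_iff] at h
    simp only [Prod.mk.injEq, Fin.ext_iff]
    omega
  rw [hE, Set.ncard_coe_finset, Finset.card_union_of_disjoint hdisj,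
    Finset.card_image_of_injOn hinj,
    Finset.card_product, card_filter_Ico (by omega), card_filter_Ico hq,
    ← card_cliqueVerts hv0 hq, ← Sym2.card_image_offDiag]
  congr 1
  obtain ⟨m, rfl | rfl⟩ := Nat.even_or_odd' q
  · rw [show 2 * m / 2 = m by omega, show (2 * m) ^ 2 = m * m * 4 by ring]
    rw [Nat.mul_div_cancel _ (by norm_num), show 2 * m - m = m by omega, Nat.sub_zero]
  · rw [show (2 * m + 1) / 2 = m by omega, show (2 * m + 1) ^ 2 = m * (m + 1) * 4 + 1 by ring]
    rw [show 2 * m + 1 - m = m + 1 by omega, Nat.sub_zero]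
    omega

lemma colorable (hv0 : v0 < q) (hq : q < n) : (turanSuspAt n q v0).Colorable (n - q + 1) := by
  refine ⟨SimpleGraph.Coloring.mk (fun i => ⟨if q ≤ (i : ℕ) then i - q + 1 else
    if ((i : ℕ) < q / 2 ↔ v0 < q / 2) then 0 else 1, ?_⟩) ?_⟩
  · have := i.2
    split_ifs <;> omega
  · intro i j hij h
    have hne : (i : ℕ) ≠ j := fun h' => hij.ne (Fin.ext h')
    have := (adj_iff.1 hij).2
    simp only [Fin.mk.injEq] at h
    split_ifs at h <;> omega

lemma chromaticNumber_eq (hv0 : v0 < q) (hq : q < n) :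
    (turanSuspAt n q v0).chromaticNumber = ((n - q + 1 : ℕ) : ℕ∞) := by
  refine le_antisymm (colorable hv0 hq).chromaticNumber_le ?_
  rw [← card_cliqueVerts hv0 hq.le]
  exact isClique_cliqueVerts.card_le_chromaticNumber

end turanSuspAt

/-- the extremal graph. For `k ≥ 2`, `3 ≤ r ≤ 2k`, `n ≥ r + 1`, any
graph obtained from the bipartite Turán graph `T_{n-r+1,2}` by suspending `K_r` (at any
vertex) is `C_{2k+1}`-free, has exactly `⌊(n-r+1)²/4⌋ + C(r,2)` edges, and has chromatic
number exactly `r`. -/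
theorem stmt_15 (k r n : ℕ) (hk : 2 ≤ k) (hr3 : 3 ≤ r) (hr : r ≤ 2 * k)
    (hn : r + 1 ≤ n) (G : SimpleGraph (Fin n)) (v0 : ℕ) (hv0 : v0 < n - r + 1)
    (hiso : Nonempty (G ≃g turanSuspAt n (n - r + 1) v0)) :
    G.CycleFree (2 * k + 1) ∧
    G.edgeSet.ncard = (n - r + 1) ^ 2 / 4 + r.choose 2 ∧
    G.chromaticNumber = (r : ℕ∞) := by
  obtain ⟨e⟩ := hiso
  have hcard : n - (n - r + 1) + 1 = r := by omega
  refine ⟨fun v w hw hlen => ?_, ?_, ?_⟩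
  · refine turanSuspAt.cycleFree_of_odd (odd_two_mul_add_one k) hv0 (by omega) (by omega)
      (w.map e.toHom) (hw.map e.injective) ?_
    rw [SimpleGraph.Walk.length_map, hlen]
  · rw [← Nat.card_coe_set_eq, Nat.card_congr e.mapEdgeSet, Nat.card_coe_set_eq,
      turanSuspAt.ncard_edgeSet hv0 (by omega), hcard]
  · rw [SimpleGraph.chromaticNumber_congr e, turanSuspAt.chromaticNumber_eq hv0 (by omega), hcard]
end

section
/- Let k ≥ 2 and n ≥ 9k be integers. If G is an n-vertex C_{2k+1}-free simple graph with spectral radius λ(G) > n/2 − k, then e(G) > n²/4 − (3k−1)n/2 + k(2k−1), and consequently e(G) > (n−5k)²/4. -/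
namespace SimpleGraph

open Finset

/-- A path inside the neighbourhood of `u` closes up to a cycle through `u`. -/
theorem CycleFree.length_add_one_ne {V : Type*} {G : SimpleGraph V} {m : ℕ} (hG : G.CycleFree m)
    (u : V) (l : List V) (hc : l.IsChain G.Adj) (hn : l.Nodup) (hu : ∀ v ∈ l, G.Adj u v)
    (hl : 2 ≤ l.length) : l.length + 1 ≠ m := by
  have hne : l ≠ [] := by rintro rfl; simp at hl
  have hp := Walk.support_ofSupport hne hc
  have hlen := Walk.length_ofSupport hne hc
  generalize Walk.ofSupport l hne hc = p at hp hlen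
  have hu' : u ∉ p.support := by
    rw [hp]; intro h; exact G.loopless.irrefl _ (hu u h)
  have hpath : p.IsPath := by rw [Walk.isPath_def, hp]; exact hn
  have hlast := (hu _ (List.getLast_mem hne)).symm
  have hhl : l.head hne ≠ l.getLast hne := by
    intro h
    rw [List.head_eq_getElem, List.getLast_eq_getElem, hn.getElem_inj_iff] at h
    omega
  have := hG (.cons (hu _ (List.head_mem hne)) (p.concat hlast)) ?_
  · rw [Walk.length_cons, Walk.length_concat, hlen] at this
    omega
  · rw [Walk.cons_isCycle_iff]
    refine ⟨hpath.concat hu' _, ?_⟩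
    rw [Walk.edges_concat]
    simp only [List.concat_eq_append, List.mem_append, List.mem_singleton, Sym2.eq_iff, not_or]
    refine ⟨fun h => hu' (p.fst_mem_support_of_mem_edges h), ?_⟩
    exact ⟨fun h => hlast.ne h.1.symm, fun h => hhl h.2⟩

/-- A closed chain can be rotated so as to start at any of its members. -/
theorem exists_isChain_cons_perm_of_closed {V : Type*} {G : SimpleGraph V} (c : List V)
    (hc : c.IsChain G.Adj)
    (hcl : ∀ x ∈ c.getLast?, ∀ y ∈ c.head?, G.Adj x y) {a : V} (ha : a ∈ c) :
    ∃ t : List V, (a :: t).IsChain G.Adj ∧ (a :: t).Perm c := by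
  obtain ⟨s, t, rfl⟩ := List.append_of_mem ha
  refine ⟨t ++ s, ?_, ?_⟩
  · rw [← List.cons_append, List.isChain_append]
    rw [List.isChain_append] at hc
    refine ⟨hc.2.1, hc.1, ?_⟩
    cases s with
    | nil => simp
    | cons b s =>
      rw [List.getLast?_append_of_ne_nil _ (List.cons_ne_nil a t)] at hcl
      simpa using hcl
  · rw [← List.cons_append]; exact List.perm_append_comm

/-- A path whose ends have crossing neighbours `l[i + 1]` and `l[i]` on it can be
rearranged into a closed chain. -/
theorem exists_closed_isChain_perm_of_crossing {V : Type*} {G : SimpleGraph V} (l : List V)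
    (hc : l.IsChain G.Adj) (i : ℕ) (hi : i + 1 < l.length)
    (h0 : G.Adj l[0] l[i+1]) (h1 : G.Adj l[l.length - 1] l[i]) :
    ∃ c : List V, c.IsChain G.Adj ∧ c.Perm l ∧ (∀ x ∈ c.getLast?, ∀ y ∈ c.head?, G.Adj x y) := by
  refine ⟨l.take (i+1) ++ (l.drop (i+1)).reverse, ?_, ?_, ?_⟩
  · rw [List.isChain_append, List.isChain_reverse]
    refine ⟨hc.take _, (hc.drop _).imp fun _ _ h => h.symm, ?_⟩
    have e1 : (l.take (i+1)).getLast? = some l[i] := by grind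
    have e2 : (l.drop (i+1)).reverse.head? = some l[l.length - 1] := by
      grind
    rw [e1, e2]
    simpa using h1.symm
  · exact (List.Perm.append_left _ (List.reverse_perm _)).trans (by rw [List.take_append_drop])
  · have e1 : (l.take (i+1) ++ (l.drop (i+1)).reverse).getLast? = some l[i+1] := by grind
    have e2 : (l.take (i+1) ++ (l.drop (i+1)).reverse).head? = some l[0] := by
      cases l with
      | nil => simp at hi
      | cons => simp
    rw [e1, e2]
    simpa using h0.symm

/-- If all degrees within `S` exceed `d` but paths in `S` have at most `2 * d + 1` vertices, then
some set of at most `2 * d + 1` vertices is a union of components of `S`. -/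
theorem exists_closed_subset_of_lt_degree {V : Type*} [DecidableEq V]
    {G : SimpleGraph V} [DecidableRel G.Adj] {d : ℕ} (S : Finset V) (hS : S.Nonempty)
    (hP : ∀ l : List V, l.IsChain G.Adj → l.Nodup → (∀ v ∈ l, v ∈ S) → l.length ≤ 2 * d + 1)
    (hdeg : ∀ v ∈ S, d < #{w ∈ S | G.Adj v w}) :
    ∃ A ⊆ S, A.Nonempty ∧ #A ≤ 2 * d + 1 ∧ ∀ a ∈ A, ∀ w ∈ S, G.Adj a w → w ∈ A := by
  let P : ℕ → Prop := fun m =>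
    ∃ l : List V, l.IsChain G.Adj ∧ l.Nodup ∧ (∀ v ∈ l, v ∈ S) ∧ l.length = m
  classical
  obtain ⟨v, hv⟩ := hS
  have hP1 : P 1 := ⟨[v], by simp, by simp, by simpa using hv, rfl⟩
  obtain ⟨l, hc, hn, hlS, hl⟩ := Nat.findGreatest_spec (P := P) (by omega : 1 ≤ 2 * d + 1) hP1
  have hmax : ∀ w ∈ S, ∀ t : List V, t.IsChain G.Adj → t.Perm l → (∀ y ∈ t.head?, G.Adj w y) →
      w ∈ l := by
    intro w hw t ht htl hwt
    by_contra hwl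
    have hmem : ∀ x ∈ w :: t, x ∈ S := by
      intro x hx
      rcases List.mem_cons.1 hx with rfl | hx
      · exact hw
      · exact hlS x (htl.mem_iff.1 hx)
    have hch : (w :: t).IsChain G.Adj := List.isChain_cons.2 ⟨hwt, ht⟩
    have hnd : (w :: t).Nodup :=
      List.nodup_cons.2 ⟨fun h => hwl (htl.mem_iff.1 h), htl.nodup_iff.2 hn⟩
    have := Nat.le_findGreatest (P := P) (hP _ hch hnd hmem) ⟨_, hch, hnd, hmem, rfl⟩
    rw [← hl, List.length_cons, htl.length_eq] at this
    omega
  have hlen1 : 1 ≤ l.length := hl ▸ Nat.le_findGreatest (by omega) hP1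
  have hlen2 := hP l hc hn hlS
  have hne : l ≠ [] := by rintro rfl; simp at hlen1
  let f : ℕ → V := fun i => l.getD i v
  have hf : ∀ i (hi : i < l.length), f i = l[i] := fun i hi => by simp [f, hi]
  set L := l.length with hL
  have h0 : #{w ∈ S | G.Adj (f 0) w} ≤ #{i ∈ range (L - 1) | G.Adj (f 0) (f (i + 1))} := by
    refine (card_le_card (t := image (fun i => f (i + 1)) _) ?_).trans card_image_le
    intro w hw
    rw [mem_filter] at hw
    have hwl : w ∈ l := by
      refine hmax w hw.1 l hc (List.Perm.refl _) ?_
      have : l.head? = some (f 0) := by rw [hf 0 (by omega), List.head?_eq_getElem?]; simp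
      rw [this]
      simpa using hw.2.symm
    obtain ⟨i, hi, rfl⟩ := List.getElem_of_mem hwl
    rw [mem_image]
    rcases i with _ | i
    · have := hw.2
      rw [hf 0 (by omega)] at this
      exact (G.irrefl this).elim
    · refine ⟨i, mem_filter.2 ⟨mem_range.2 (by omega), ?_⟩, hf _ hi⟩
      rw [hf (i + 1) hi]; exact hw.2
  have h1 : #{w ∈ S | G.Adj (f (L - 1)) w} ≤ #{i ∈ range (L - 1) | G.Adj (f (L - 1)) (f i)} := by
    refine (card_le_card (t := image f _) ?_).trans card_image_le
    intro w hw
    rw [mem_filter] at hw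
    have hwl : w ∈ l := by
      refine hmax w hw.1 l.reverse ?_ (List.reverse_perm _) ?_
      · rw [List.isChain_reverse]; exact hc.imp fun _ _ h => h.symm
      have : l.reverse.head? = some (f (L - 1)) := by
        rw [hf _ (by omega), List.head?_reverse, List.getLast?_eq_getElem?]
        exact List.getElem?_eq_getElem _
      rw [this]
      simpa using hw.2.symm
    obtain ⟨i, hi, rfl⟩ := List.getElem_of_mem hwl
    rw [mem_image]
    by_cases hiL : i = L - 1
    · subst hiL
      have := hw.2
      rw [hf (L - 1) (by omega)] at this
      exact (G.irrefl this).elim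
    · refine ⟨i, mem_filter.2 ⟨mem_range.2 (by omega), ?_⟩, hf _ hi⟩
      rw [hf i hi]; exact hw.2
  have hfS : ∀ i < L, f i ∈ S := fun i hi => by rw [hf i hi]; exact hlS _ (List.getElem_mem _)
  have d0 := hdeg _ (hfS 0 (by omega))
  have d1 := hdeg _ (hfS (L - 1) (by omega))
  have hint : ({i ∈ range (L - 1) | G.Adj (f 0) (f (i + 1))} ∩
      {i ∈ range (L - 1) | G.Adj (f (L - 1)) (f i)}).Nonempty := by
    apply inter_nonempty_of_card_lt_card_add_card (filter_subset _ _) (filter_subset _ _)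
    rw [card_range]
    omega
  obtain ⟨i, hi⟩ := hint
  simp only [mem_inter, mem_filter, mem_range] at hi
  obtain ⟨⟨hi, ha⟩, -, hb⟩ := hi
  rw [hf _ (by omega), hf _ (by omega)] at ha hb
  obtain ⟨c, hcc, hcp, hcl⟩ := exists_closed_isChain_perm_of_crossing l hc i (by omega) ha hb
  refine ⟨l.toFinset, fun x hx => hlS x (List.mem_toFinset.1 hx), ⟨f 0, ?_⟩, ?_, ?_⟩
  · rw [List.mem_toFinset, hf 0 (by omega)]; exact List.getElem_mem _
  · exact (List.toFinset_card_le l).trans hlen2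
  · intro a ha w hw haw
    rw [List.mem_toFinset] at ha ⊢
    obtain ⟨t, ht, htc⟩ := exists_isChain_cons_perm_of_closed c hcc hcl (hcp.mem_iff.2 ha)
    exact hmax w hw _ ht (htc.trans hcp) (by simpa using haw.symm)

/-- The Erdős–Gallai theorem for paths with an even number of vertices,
as a bound on a degree sum. -/
theorem sum_card_adj_le_of_path_length_le {V : Type*} [DecidableEq V]
    {G : SimpleGraph V} [DecidableRel G.Adj] {d : ℕ} (S : Finset V)
    (hP : ∀ l : List V, l.IsChain G.Adj → l.Nodup → (∀ v ∈ l, v ∈ S) → l.length ≤ 2 * d + 1) :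
    ∑ v ∈ S, #{w ∈ S | G.Adj v w} ≤ 2 * d * #S := by
  induction S using Finset.strongInduction with
  | H S ih =>
  rcases S.eq_empty_or_nonempty with rfl | hS
  · simp
  have key : ∃ A ⊆ S, A.Nonempty ∧ ∑ v ∈ A, #{w ∈ S | G.Adj v w} +
      ∑ v ∈ S \ A, #{w ∈ A | G.Adj v w} ≤ 2 * d * #A := by
    by_cases hdeg : ∀ v ∈ S, d < #{w ∈ S | G.Adj v w}
    · obtain ⟨A, hA, hAn, hAc, hAcl⟩ := exists_closed_subset_of_lt_degree S hS hP hdeg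
      refine ⟨A, hA, hAn, ?_⟩
      have e1 : ∑ v ∈ S \ A, #{w ∈ A | G.Adj v w} = 0 := by
        refine sum_eq_zero fun v hv => ?_
        rw [mem_sdiff] at hv
        rw [card_eq_zero, filter_eq_empty_iff]
        exact fun w hw h => hv.2 (hAcl w hw v hv.1 h.symm)
      have e2 : ∀ v ∈ A, #{w ∈ S | G.Adj v w} ≤ 2 * d := by
        intro v hv
        have : #{w ∈ S | G.Adj v w} ≤ #(A.erase v) := by
          refine card_le_card fun w hw => ?_
          rw [mem_filter] at hw
          exact mem_erase.2 ⟨hw.2.ne', hAcl v hv w hw.1 hw.2⟩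
        rw [card_erase_of_mem hv] at this
        omega
      have := sum_le_card_nsmul A _ _ e2
      rw [e1, smul_eq_mul] at *
      linarith
    · push Not at hdeg
      obtain ⟨v, hv, hd⟩ := hdeg
      refine ⟨{v}, by simpa using hv, by simp, ?_⟩
      have : ∑ x ∈ S \ {v}, #{w ∈ ({v} : Finset V) | G.Adj x w} ≤ #{w ∈ S | G.Adj v w} := by
        rw [card_filter]
        refine (sum_le_sum_of_subset sdiff_subset).trans (sum_le_sum fun x _ => ?_)
        simp [filter_singleton, G.adj_comm x v]
        split_ifs <;> simp
      simp only [sum_singleton, card_singleton]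
      omega
  obtain ⟨A, hA, hAn, hle⟩ := key
  have ih' := ih (S \ A) (sdiff_ssubset hA hAn)
    fun l h1 h2 h3 => hP l h1 h2 fun v hv => (mem_sdiff.1 (h3 v hv)).1
  have hsplit : ∀ v, #{w ∈ S | G.Adj v w} = #{w ∈ S \ A | G.Adj v w} + #{w ∈ A | G.Adj v w} := by
    intro v
    simp only [card_filter]
    exact (sum_sdiff hA).symm
  have hc := card_sdiff_add_card_eq_card hA
  rw [← sum_sdiff hA]
  have : ∑ v ∈ S \ A, #{w ∈ S | G.Adj v w} = ∑ v ∈ S \ A, #{w ∈ S \ A | G.Adj v w} +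
      ∑ v ∈ S \ A, #{w ∈ A | G.Adj v w} := by
    rw [← sum_add_distrib]
    exact sum_congr rfl fun v _ => hsplit v
  rw [this, ← hc, mul_add]
  omega

/-- A bound on `(A² y - d A y) u`, where `A` is the adjacency matrix and `0 ≤ y ≤ 1`, when the
neighbourhood of `u` is locally sparse. -/
theorem sum_sum_neighbor_sub_le_card_edgeFinset {V : Type*} [Fintype V] [DecidableEq V]
    {G : SimpleGraph V} [DecidableRel G.Adj] {d : ℕ} (u : V)
    (hd : ∀ S ⊆ ({v | G.Adj u v} : Finset V), ∑ v ∈ S, #{w ∈ S | G.Adj v w} ≤ 2 * d * #S)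
    (y : V → ℝ) (hy0 : ∀ v, 0 ≤ y v) (hy1 : ∀ v, y v ≤ 1) :
    ∑ v with G.Adj u v, ∑ w with G.Adj v w, y w - d * ∑ v with G.Adj u v, y v ≤ #G.edgeFinset := by
  set a : V → V → ℝ := fun v w => if G.Adj v w then 1 else 0 with ha
  have asymm : ∀ v w, a v w = a w v := fun v w => by simp [ha, G.adj_comm]
  have a0 : ∀ v w, 0 ≤ a v w := fun v w => by simp only [ha]; split_ifs <;> norm_num
  set N : Finset V := {v | G.Adj u v} with hN
  set W : Finset V := ({v | ¬ G.Adj u v} : Finset V).erase u with hW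
  have hsplit : ∀ f : V → ℝ, ∑ v, f v = ∑ v ∈ N, f v + ∑ v ∈ W, f v + f u := by
    intro f
    rw [add_assoc, hW, sum_erase_add _ _ (by simp), hN, sum_filter_add_sum_filter_not]
  let E : Finset V → Finset V → ℝ := fun X Y => ∑ v ∈ X, ∑ w ∈ Y, a v w
  have Ecomm : ∀ X Y, E X Y = E Y X := fun X Y => by
    simp only [E]; rw [sum_comm]; simp only [asymm]
  have E0 : ∀ X Y, 0 ≤ E X Y := fun X Y => sum_nonneg fun v _ => sum_nonneg fun w _ => a0 v w
  have hedge : 2 * (#G.edgeFinset : ℝ) = E univ univ := by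
    have := G.sum_degrees_eq_twice_card_edges
    have h2 : ((∑ v, G.degree v : ℕ) : ℝ) = 2 * #G.edgeFinset := by rw [this]; push_cast; rfl
    rw [← h2]
    push_cast
    refine sum_congr rfl fun v _ => ?_
    simp only [ha, sum_boole]
    rw [← G.card_neighborFinset_eq_degree, G.neighborFinset_eq_filter]
  have hNu : ∀ v ∈ N, a v u = 1 := fun v hv => by
    simp only [hN, mem_filter, mem_univ, true_and] at hv
    simp [ha, hv.symm]
  have hEdges : E N N + 2 * E N W + 2 * (#N : ℝ) ≤ E univ univ := by
    have h1 : E univ univ = E N univ + E W univ + ∑ w, a u w := hsplit _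
    have h2 : E N univ = E N N + E N W + #N := by
      simp only [E, hsplit, sum_add_distrib]
      rw [sum_congr rfl hNu]; simp
    have h3 : E W N ≤ E W univ := sum_le_sum fun v _ => by
      refine sum_le_sum_of_subset_of_nonneg (subset_univ _) fun w _ _ => a0 _ _
    have h4 : (#N : ℝ) ≤ ∑ w, a u w := by simp [ha, hN]
    linarith [Ecomm W N]
  have hQ1 : ∑ v ∈ N, ∑ w with G.Adj v w, y w ≤
      ∑ v ∈ N, (∑ w ∈ N, a v w) * y v + E N W + (#N : ℝ) := by
    have h1 : ∀ v ∈ N, ∑ w with G.Adj v w, y w ≤ ∑ w ∈ N, a v w * y w + ∑ w ∈ W, a v w + 1 := by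
      intro v hv
      have : ∑ w with G.Adj v w, y w = ∑ w, a v w * y w := by
        rw [sum_filter]; exact sum_congr rfl fun w _ => by simp [ha]
      rw [this, hsplit, hNu v hv, one_mul]
      gcongr with w
      · exact mul_le_of_le_one_right (a0 _ _) (hy1 _)
      · exact hy1 u
    refine (Finset.sum_le_sum h1).trans_eq ?_
    rw [sum_add_distrib, sum_add_distrib, sum_comm]
    simp [E, sum_mul, asymm]
  set S : Finset V := {v ∈ N | (d : ℝ) ≤ ∑ w ∈ N, a v w} with hS
  have hSN : S ⊆ N := filter_subset _ _
  have hQ2 : ∑ v ∈ N, (∑ w ∈ N, a v w) * y v - d * ∑ v ∈ N, y v ≤ E S N - d * #S := by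
    have h1 : E S N - d * #S = ∑ v ∈ S, (∑ w ∈ N, a v w - d) := by
      simp [E, sum_sub_distrib, mul_comm]
    have h2 : ∑ v ∈ S, (∑ w ∈ N, a v w - d) =
        ∑ v ∈ N, if (d : ℝ) ≤ ∑ w ∈ N, a v w then ∑ w ∈ N, a v w - d else 0 := sum_filter _ _
    rw [h1, h2, mul_sum, ← sum_sub_distrib]
    refine Finset.sum_le_sum fun v _ => ?_
    split_ifs with h
    · nlinarith [hy0 v, hy1 v]
    · nlinarith [hy0 v, hy1 v]
  have hSS : E S S ≤ 2 * d * #S := by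
    have := hd S hSN
    have h2 : ((∑ v ∈ S, #{w ∈ S | G.Adj v w} : ℕ) : ℝ) ≤ 2 * d * #S := by exact_mod_cast this
    simpa [E, ha] using h2
  have e1 : E S N = E S (N \ S) + E S S := by
    simp only [E, ← sum_sdiff hSN, sum_add_distrib]
  have e2 : E N N = E (N \ S) (N \ S) + E (N \ S) S + (E S (N \ S) + E S S) := by
    simp only [E, ← sum_sdiff hSN, sum_add_distrib]
  linarith [E0 (N \ S) (N \ S), Ecomm S (N \ S)]

/-- If all neighbourhoods are locally sparse, an eigenvalue `μ ≥ d` satisfies `μ² - d μ ≤ e(G)`. -/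
theorem sq_sub_mul_le_card_edgeFinset_of_mulVec_eq {V : Type*} [Fintype V] [DecidableEq V]
    {G : SimpleGraph V} [DecidableRel G.Adj] {d : ℕ}
    (hd : ∀ u, ∀ S ⊆ ({v | G.Adj u v} : Finset V), ∑ v ∈ S, #{w ∈ S | G.Adj v w} ≤ 2 * d * #S)
    {μ : ℝ} (hμ : d ≤ μ) {x : V → ℝ} (hx : x ≠ 0) (h : (G.adjMatrix ℝ).mulVec x = μ • x) :
    μ ^ 2 - d * μ ≤ #G.edgeFinset := by
  have : Nonempty V := by
    by_contra hV
    rw [not_nonempty_iff] at hV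
    exact hx (Subsingleton.elim _ _)
  obtain ⟨u, hu⟩ := Finite.exists_max fun v => |x v|
  have hpos : 0 < |x u| := by
    obtain ⟨v, hv⟩ := Function.ne_iff.1 hx
    exact (abs_pos.2 hv).trans_le (hu v)
  have hμ0 : 0 ≤ μ := d.cast_nonneg.trans hμ
  let y : V → ℝ := fun v => |x v| / |x u|
  have hyu : y u = 1 := div_self hpos.ne'
  have hy : ∀ v, μ * y v ≤ ∑ w with G.Adj v w, y w := by
    intro v
    have h1 := congrFun h v
    rw [adjMatrix_mulVec_apply, Pi.smul_apply, smul_eq_mul, G.neighborFinset_eq_filter] at h1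
    have h2 : μ * |x v| ≤ ∑ w with G.Adj v w, |x w| := by
      rw [← abs_of_nonneg hμ0, ← abs_mul, ← h1]
      exact abs_sum_le_sum_abs _ _
    simp only [y]
    rw [← sum_div, ← mul_div_assoc]
    gcongr
  have hc := sum_sum_neighbor_sub_le_card_edgeFinset u (hd u) y (fun v => by positivity)
    (fun v => (div_le_one hpos).2 (hu v))
  have h1 : μ * ∑ v with G.Adj u v, y v ≤ ∑ v with G.Adj u v, ∑ w with G.Adj v w, y w := by
    rw [mul_sum]; exact sum_le_sum fun v _ => hy v
  have h2 := hy u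
  rw [hyu] at h2
  nlinarith

end SimpleGraph

/-- edge count from the spectral bound, via the
Brualdi–Hoffman–Turán-type Lemma 2.4. Let `k ≥ 2` and `n ≥ 9k`. If `G` is an `n`-vertex
`C_{2k+1}`-free graph with `λ(G) > n/2 - k`, then
`e(G) > n²/4 - (3k-1)n/2 + k(2k-1)`, and consequently `e(G) > (n-5k)²/4`. -/
theorem stmt_16 (k n : ℕ) (hk : 2 ≤ k) (hn : 9 * k ≤ n)
    (G : SimpleGraph (Fin n)) (hfree : G.CycleFree (2 * k + 1))
    (hlam : (n : ℝ) / 2 - k < G.specRad) :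
    (n : ℝ) ^ 2 / 4 - (3 * (k : ℝ) - 1) * n / 2 + (k : ℝ) * (2 * k - 1)
        < (G.edgeSet.ncard : ℝ) ∧
      ((n : ℝ) - 5 * k) ^ 2 / 4 < (G.edgeSet.ncard : ℝ) := by
  classical
  have hk' : (2 : ℝ) ≤ k := by exact_mod_cast hk
  have hn' : 9 * (k : ℝ) ≤ n := by exact_mod_cast hn
  have hsparse : ∀ u, ∀ S ⊆ ({v | G.Adj u v} : Finset (Fin n)),
      ∑ v ∈ S, (S.filter fun w => G.Adj v w).card ≤ 2 * (k - 1) * S.card := by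
    intro u S hS
    refine SimpleGraph.sum_card_adj_le_of_path_length_le S fun l hc hnd hlS => ?_
    by_contra hlen
    have h2k : (l.take (2 * k)).length = 2 * k := by rw [List.length_take]; omega
    refine hfree.length_add_one_ne u (l.take (2 * k)) (hc.take _)
      (hnd.sublist (List.take_sublist _ _)) (fun v hv => ?_) (by omega) (by rw [h2k])
    simpa using hS (hlS v (List.mem_of_mem_take hv))
  have hedge : (G.edgeSet.ncard : ℝ) = G.edgeFinset.card := by
    rw [← SimpleGraph.coe_edgeFinset, Set.ncard_coe_finset]
  have hne : {μ : ℝ | ∃ x : Fin n → ℝ, x ≠ 0 ∧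
      (@SimpleGraph.adjMatrix ℝ _ G (Classical.decRel _) _ _).mulVec x = μ • x}.Nonempty := by
    by_contra hemp
    rw [Set.not_nonempty_iff_eq_empty] at hemp
    rw [SimpleGraph.specRad, hemp, Real.sSup_empty] at hlam
    linarith
  obtain ⟨μ, ⟨x, hx, hμx⟩, hμ⟩ := exists_lt_of_lt_csSup hne hlam
  have hk1 : ((k - 1 : ℕ) : ℝ) = k - 1 := by
    rw [Nat.cast_sub (by omega), Nat.cast_one]
  have hbound : μ ^ 2 - (k - 1 : ℕ) * μ ≤ G.edgeFinset.card :=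
    SimpleGraph.sq_sub_mul_le_card_edgeFinset_of_mulVec_eq hsparse
      (by rw [hk1]; linarith) hx (by convert hμx)
  rw [hk1] at hbound
  have hmain : (n : ℝ) ^ 2 / 4 - (3 * (k : ℝ) - 1) * n / 2 + (k : ℝ) * (2 * k - 1)
      < (G.edgeSet.ncard : ℝ) := by
    rw [hedge]
    have : 0 < (μ - (n / 2 - k)) * (μ + (n / 2 - k) - (k - 1)) :=
      mul_pos (by linarith) (by linarith)
    nlinarith
  exact ⟨hmain, by nlinarith⟩
end
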